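/- Let K be a field, let P be the kernel of the K-algebra homomorphism φ: K[x_1,...,x_n] → K[y_1,...,y_m] defined by φ(x_i) = f_i with f_i homogeneous of common degree d > 0. Let J' = (x_1^d − f_1, ..., x_n^d − f_n) in S = K[x_1,...,x_n,y_1,...,y_m] and let G_{n,d,m} = reg(Lex(J')) be the regularity of the lexicographic ideal of J'. Then reg(P) ≤ G_{n,d,m}/d. -/

import Mathlib

open MvPolynomial

variable {K : Type} [Field K]

/-- The degree-`k` homogeneous component of a homogeneous ideal `I`,
as a `K`-vector subspace of the polynomial ring (zero in negative degrees). -/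
noncomputable def idealPiece {n : ℕ} (I : Ideal (MvPolynomial (Fin n) K)) (k : ℤ) :
    Submodule K (MvPolynomial (Fin n) K) :=
  if 0 ≤ k then
    (Submodule.restrictScalars K (I : Submodule (MvPolynomial (Fin n) K) (MvPolynomial (Fin n) K)))
      ⊓ (homogeneousSubmodule (Fin n) K k.toNat)
  else ⊥

lemma mul_X_mem_idealPiece {n : ℕ} (I : Ideal (MvPolynomial (Fin n) K)) (t : Fin n) (k : ℤ)
    {x : MvPolynomial (Fin n) K} (hx : x ∈ idealPiece I k) :
    (X t : MvPolynomial (Fin n) K) * x ∈ idealPiece I (k + 1) := by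
  by_cases h : 0 ≤ k
  · rw [idealPiece, if_pos h] at hx
    rw [idealPiece, if_pos (by omega)]
    refine ⟨I.mul_mem_left _ hx.1, ?_⟩
    rw [Submodule.mem_inf] at hx
    have hh : x.IsHomogeneous k.toNat := (mem_homogeneousSubmodule _ _).1 hx.2
    have : ((X t : MvPolynomial (Fin n) K) * x).IsHomogeneous (1 + k.toNat) :=
      (isHomogeneous_X K t).mul hh
    have he : (k + 1).toNat = 1 + k.toNat := by omega
    exact (mem_homogeneousSubmodule _ _).2 (he ▸ this)
  · rw [idealPiece, if_neg h, Submodule.mem_bot] at hx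
    rw [hx, mul_zero]
    exact Submodule.zero_mem _

/-- Multiplication by the variable `X t` as a linear map between graded pieces. -/
noncomputable def mulXPiece {n : ℕ} (I : Ideal (MvPolynomial (Fin n) K)) (t : Fin n) (k : ℤ) :
    idealPiece I k →ₗ[K] idealPiece I (k + 1) :=
  (LinearMap.mulLeft K (X t)).restrict (fun _ hx => mul_X_mem_idealPiece I t k hx)

/-- Index set of the `i`-th term of the Koszul complex: subsets of the variables of size `i`. -/
abbrev KoszulIdx (n i : ℕ) := {s : Finset (Fin n) // s.card = i}

/-- The Koszul differential (in internal degree `j`) of the complex computing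
`Tor(I, K)`, from homological degree `i+1` to homological degree `i`. -/
noncomputable def koszulDiff {n : ℕ} (I : Ideal (MvPolynomial (Fin n) K)) (i : ℕ) (j : ℤ) :
    ((KoszulIdx n (i + 1)) → idealPiece I (j - (i + 1 : ℕ)))
      →ₗ[K] ((KoszulIdx n i) → idealPiece I (j - (i : ℕ))) :=
  ∑ s' : KoszulIdx n (i + 1), ∑ t ∈ (s' : Finset (Fin n)).attach,
    ((-1 : K) ^ (((s' : Finset (Fin n)).filter (fun u => u < t.1)).card)) •
      ((LinearMap.single (R := K) (φ := fun _ : KoszulIdx n i => idealPiece I (j - (i : ℕ)))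
          ⟨(s' : Finset (Fin n)).erase t.1, by
            rw [Finset.card_erase_of_mem t.2, s'.2]; rfl⟩) ∘ₗ
        (LinearEquiv.ofEq _ _ (by rw [show j - ((i : ℕ) + 1 : ℕ) + 1 = j - (i : ℕ) by push_cast; ring])).toLinearMap ∘ₗ
        (mulXPiece I t.1 (j - ((i : ℕ) + 1 : ℕ))) ∘ₗ
        (LinearMap.proj s'))

/-- Cycles of the Koszul complex at homological degree `i`, internal degree `j`. -/
noncomputable def koszulCycles {n : ℕ} (I : Ideal (MvPolynomial (Fin n) K)) :
    (i : ℕ) → (j : ℤ) → Submodule K ((KoszulIdx n i) → idealPiece I (j - (i : ℕ)))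
  | 0, _ => ⊤
  | (i + 1), j => LinearMap.ker (koszulDiff I i j)

set_option synthInstance.maxHeartbeats 1000000 in
set_option maxHeartbeats 1000000 in
/-- The graded Betti number `β_{i,j}(I) = dim_K Tor_i(I, K)_j`, computed as the dimension
of the homology of the Koszul complex (all spaces involved are finite-dimensional, so the
dimension of the homology `Z/B` is `dim Z - dim (B ⊓ Z)`). -/
noncomputable def gradedBetti {n : ℕ} (I : Ideal (MvPolynomial (Fin n) K)) (i : ℕ) (j : ℤ) : ℕ :=
  Module.finrank K ↥(koszulCycles I i j) -
    Module.finrank K ↥(LinearMap.range (koszulDiff I i j) ⊓ koszulCycles I i j)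

/-- The Castelnuovo–Mumford regularity `reg(I) = max { j - i : β_{i,j}(I) ≠ 0 }`. -/
noncomputable def reg {n : ℕ} (I : Ideal (MvPolynomial (Fin n) K)) : ℤ :=
  sSup {r : ℤ | ∃ (i : ℕ) (j : ℤ), gradedBetti I i j ≠ 0 ∧ r = j - i}

/-- `t_i(I) = max { j : β_{i,j}(I) ≠ 0 }`, the maximal shift in homological degree `i`. -/
noncomputable def maxShift {n : ℕ} (I : Ideal (MvPolynomial (Fin n) K)) (i : ℕ) : ℤ :=
  sSup {j : ℤ | gradedBetti I i j ≠ 0}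

/-- The projective dimension of `I`. -/
noncomputable def projdim {n : ℕ} (I : Ideal (MvPolynomial (Fin n) K)) : ℕ :=
  sSup {i : ℕ | ∃ j : ℤ, gradedBetti I i j ≠ 0}

/-- An ideal of a polynomial ring is homogeneous (for the standard grading) if it contains
all homogeneous components of its elements. -/
def IsHomogeneousIdeal {n : ℕ} (I : Ideal (MvPolynomial (Fin n) K)) : Prop :=
  ∀ f ∈ I, ∀ k : ℕ, homogeneousComponent k f ∈ I

/-- The lexicographic order on exponent vectors of monomials in `x_1,…,x_ℓ` with
`x_ℓ > x_{ℓ-1} > … > x_1` : `v < w` iff `w` beats `v` at the largest index where they differ. -/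
def LexLT {ℓ : ℕ} (v w : Fin ℓ →₀ ℕ) : Prop :=
  ∃ i : Fin ℓ, v i < w i ∧ ∀ j : Fin ℓ, i < j → v j = w j

/-- The lexicographic ideal `Lex(J)` of a homogeneous ideal `J`: in each degree `k` it is
spanned by the `dim_K J_k` largest monomials of degree `k` in the lexicographic order.
A monomial `x^v` of degree `k` is among the `N` largest ones exactly when the number of
monomials of degree `k` that are `≥ x^v` is at most `N`. -/
noncomputable def LexIdeal {ℓ : ℕ} (J : Ideal (MvPolynomial (Fin ℓ) K)) :
    Ideal (MvPolynomial (Fin ℓ) K) :=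
  Ideal.span { p | ∃ v : Fin ℓ →₀ ℕ,
    Set.ncard {w : Fin ℓ →₀ ℕ | (∑ i, w i) = (∑ i, v i) ∧ (v = w ∨ LexLT v w)} ≤
      Module.finrank K ↥(idealPiece J ((∑ i, v i : ℕ) : ℤ)) ∧ p = monomial v (1 : K) }

/-- Two strictly increasing sequences of naturals enumerating a set determine the counting
function of that set. -/
lemma lt_count_range_iff {f : ℕ → ℕ} (hf : StrictMono f) [DecidablePred (· ∈ Set.range f)]
    (n c : ℕ) : n < Nat.count (· ∈ Set.range f) c ↔ f n < c := by
  have key : ∀ n, Nat.count (· ∈ Set.range f) (f n) = n := by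
    intro n
    rw [Nat.count_eq_card_filter_range]
    have : (Finset.range (f n)).filter (· ∈ Set.range f) = (Finset.range n).image f := by
      ext q
      simp only [Finset.mem_filter, Finset.mem_range, Set.mem_range, Finset.mem_image]
      constructor
      · rintro ⟨h, p, rfl⟩
        exact ⟨p, hf.lt_iff_lt.1 h, rfl⟩
      · rintro ⟨p, h, rfl⟩
        exact ⟨hf h, p, rfl⟩
    rw [this, Finset.card_image_of_injective _ hf.injective, Finset.card_range]
  constructor
  · intro h
    rw [← key n] at h
    exact Nat.lt_of_count_lt_count h
  · intro h
    calc n < n + 1 := Nat.lt_succ_self n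
      _ = Nat.count (· ∈ Set.range f) (f n + 1) := by
        rw [Nat.count_succ, key, if_pos ⟨n, rfl⟩]
      _ ≤ _ := Nat.count_monotone _ h

open Classical in
/-- The number of elements below `c` in the range of `f`. -/
noncomputable def countRange (f : ℕ → ℕ) (c : ℕ) : ℕ := Nat.count (· ∈ Set.range f) c

lemma lt_countRange_iff {f : ℕ → ℕ} (hf : StrictMono f) (n c : ℕ) :
    n < countRange f c ↔ f n < c := by
  classical
  exact lt_count_range_iff hf n c

lemma countRange_le_iff {f : ℕ → ℕ} (hf : StrictMono f) (n c : ℕ) :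
    countRange f c ≤ n ↔ c ≤ f n := by
  rw [← not_lt, lt_countRange_iff hf, not_lt]

lemma countRange_add_countRange {f g : ℕ → ℕ} (h : ∀ q, q ∈ Set.range f ↔ q ∉ Set.range g)
    (c : ℕ) : countRange f c + countRange g c = c := by
  classical
  induction c with
  | zero => simp [countRange]
  | succ c ih =>
    simp only [countRange, Nat.count_succ] at ih ⊢
    have := h c
    by_cases hc : c ∈ Set.range g
    · rw [if_pos hc, if_neg (by tauto)]
      omega
    · rw [if_neg hc, if_pos (by tauto)]
      omega

section Order

/-- A linear order which is infinite with finite initial segments is isomorphic to `ℕ`. -/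
lemma nonempty_orderIso_nat {α : Type} [LinearOrder α] [Infinite α]
    (h : ∀ a : α, (Set.Iio a).Finite) : Nonempty (α ≃o ℕ) := by
  let r : α → ℕ := fun a => (Set.Iio a).ncard
  have hr : StrictMono r := fun a b hab =>
    Set.ncard_lt_ncard ⟨Set.Iio_subset_Iio hab.le, fun h' => lt_irrefl a (h' hab)⟩ (h b)
  have lower : ∀ n a, r a = n → ∀ m ≤ n, ∃ b, r b = m := by
    intro n
    induction n with
    | zero => intro a ha m hm; exact ⟨a, by omega⟩
    | succ n ih =>
      intro a ha m hm
      rcases Nat.lt_or_ge n m with h1 | h1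
      · exact ⟨a, by omega⟩
      · have hne : (Set.Iio a).Nonempty := by
          rw [Set.nonempty_iff_ne_empty]
          intro he
          simp [r, he] at ha
        obtain ⟨b, hb, hmax⟩ := (h a).exists_maximal hne
        have : Set.Iio a = insert b (Set.Iio b) := by
          ext c
          simp only [Set.mem_Iio, Set.mem_insert_iff]
          constructor
          · intro hc
            rcases lt_trichotomy c b with h2 | h2 | h2
            · exact Or.inr h2
            · exact Or.inl h2
            · exact absurd (hmax hc h2.le) (not_le.2 h2)
          · rintro (rfl | hc)
            · exact hb
            · exact hc.trans hb
        have hcard : r a = r b + 1 := by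
          simp only [r, this]
          exact Set.ncard_insert_of_notMem (by simp) (h b)
        exact ih b (by omega) m h1
  have surj : Function.Surjective r := by
    intro n
    obtain ⟨m, ⟨a, rfl⟩, hm⟩ := (Set.infinite_range_of_injective hr.injective).exists_gt n
    exact lower _ a rfl n hm.le
  exact ⟨StrictMono.orderIsoOfSurjective r hr surj⟩

end Order

/-- Monomials of degree `k` in countably many variables, compared at the largest variable
where the exponents differ. -/
abbrev DegMon (k : ℕ) := {v : Colex (ℕ →₀ ℕ) // (ofColex v).degree = k}

namespace DegMon

variable {k : ℕ}

/-- The exponent of the variable `i`. -/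
def exp (v : DegMon k) (i : ℕ) : ℕ := ofColex v.1 i

lemma ext_exp {v w : DegMon k} (h : ∀ i, v.exp i = w.exp i) : v = w :=
  Subtype.ext (ofColex.injective (Finsupp.ext h))

lemma lt_iff {v w : DegMon k} :
    v < w ↔ ∃ i, (∀ j, i < j → v.exp j = w.exp j) ∧ v.exp i < w.exp i :=
  Finsupp.Colex.lt_iff

/-- Replace every variable by the next one. -/
noncomputable def shift (v : DegMon k) : DegMon k :=
  ⟨toColex ((ofColex v.1).mapDomain Nat.succ), (Finsupp.degree_mapDomain _ _).trans v.2⟩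

@[simp] lemma shift_exp_zero (v : DegMon k) : v.shift.exp 0 = 0 :=
  Finsupp.mapDomain_of_notMem_range _ _ (by simp)

@[simp] lemma shift_exp_succ (v : DegMon k) (i : ℕ) : v.shift.exp (i + 1) = v.exp i :=
  Finsupp.mapDomain_apply Nat.succ_injective _ _

/-- Multiply by the smallest variable. -/
noncomputable def cons (v : DegMon k) : DegMon (k + 1) :=
  ⟨toColex (ofColex v.1 + Finsupp.single 0 1), by
    simp [map_add, v.2]⟩

@[simp] lemma cons_exp_zero (v : DegMon k) : v.cons.exp 0 = v.exp 0 + 1 := by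
  simp [cons, exp]

@[simp] lemma cons_exp_succ (v : DegMon k) (i : ℕ) : v.cons.exp (i + 1) = v.exp (i + 1) := by
  simp [cons, exp]

lemma shift_strictMono : StrictMono (shift (k := k)) := by
  intro v w h
  obtain ⟨i, h1, h2⟩ := lt_iff.1 h
  refine lt_iff.2 ⟨i + 1, ?_, by simpa using h2⟩
  intro j hj
  obtain ⟨j, rfl⟩ : ∃ l, j = l + 1 := ⟨j - 1, by omega⟩
  simpa using h1 j (by omega)

lemma cons_strictMono : StrictMono (cons (k := k)) := by
  intro v w h
  obtain ⟨i, h1, h2⟩ := lt_iff.1 h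
  refine lt_iff.2 ⟨i, ?_, ?_⟩
  · intro j hj
    obtain ⟨j, rfl⟩ : ∃ l, j = l + 1 := ⟨j - 1, by omega⟩
    simpa using h1 _ hj
  · cases i <;> simpa using h2

lemma mem_range_shift {v : DegMon k} : v ∈ Set.range (shift (k := k)) ↔ v.exp 0 = 0 := by
  constructor
  · rintro ⟨w, rfl⟩; simp
  · intro h
    have hmap : ((ofColex v.1).comapDomain Nat.succ Nat.succ_injective.injOn).mapDomain Nat.succ
        = ofColex v.1 := by
      apply Finsupp.mapDomain_comapDomain _ Nat.succ_injective
      intro i hi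
      rcases i with _ | i
      · exact absurd h (by simpa [exp] using hi)
      · exact ⟨i, rfl⟩
    refine ⟨⟨toColex ((ofColex v.1).comapDomain Nat.succ Nat.succ_injective.injOn), ?_⟩, ?_⟩
    · have := v.2
      rw [← hmap, Finsupp.degree_mapDomain] at this
      exact this
    · exact Subtype.ext (congrArg toColex hmap)

lemma mem_range_cons {v : DegMon (k + 1)} : v ∈ Set.range (cons (k := k)) ↔ v.exp 0 ≠ 0 := by
  constructor
  · rintro ⟨w, rfl⟩; simp
  · intro h
    have hle : Finsupp.single 0 1 ≤ ofColex v.1 := by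
      rw [Finsupp.single_le_iff]
      exact Nat.one_le_iff_ne_zero.2 h
    have hadd := tsub_add_cancel_of_le hle
    have hdeg : (ofColex v.1 - Finsupp.single 0 1).degree = k := by
      have := v.2
      rw [← hadd, map_add] at this
      simpa using this
    let w : DegMon k := ⟨toColex (ofColex v.1 - Finsupp.single 0 1), hdeg⟩
    have hw : w.cons.1 = v.1 := congrArg toColex hadd
    exact ⟨w, Subtype.ext hw⟩

/-- The smallest variable occurring in a monomial. -/
noncomputable def minVar (v : DegMon k) : ℕ := sInf {i | v.exp i ≠ 0}

lemma exp_minVar_ne_zero (v : DegMon (k + 1)) : v.exp v.minVar ≠ 0 := by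
  have hne : {i | v.exp i ≠ 0}.Nonempty := by
    by_contra h
    have h0 : ofColex v.1 = 0 := by
      ext i
      by_contra hi
      exact h ⟨i, hi⟩
    have := v.2
    simp [h0] at this
  exact Nat.sInf_mem hne

lemma exp_eq_zero_of_lt_minVar (v : DegMon k) {i : ℕ} (h : i < v.minVar) : v.exp i = 0 := by
  by_contra hi
  exact (Nat.sInf_le (show i ∈ {i | v.exp i ≠ 0} from hi)).not_gt h

lemma minVar_eq {v : DegMon (k + 1)} {i : ℕ} (h : v.exp i ≠ 0) (h' : ∀ j < i, v.exp j = 0) :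
    v.minVar = i := by
  rcases lt_trichotomy v.minVar i with h1 | h1 | h1
  · exact absurd (h' _ h1) v.exp_minVar_ne_zero
  · exact h1
  · exact absurd (v.exp_eq_zero_of_lt_minVar h1) h

/-- Divide by a variable. -/
noncomputable def div (v : DegMon (k + 1)) (t : ℕ) (h : v.exp t ≠ 0) : DegMon k :=
  ⟨toColex (ofColex v.1 - Finsupp.single t 1), by
    have hle : Finsupp.single t 1 ≤ ofColex v.1 := by
      rw [Finsupp.single_le_iff]
      exact Nat.one_le_iff_ne_zero.2 h
    have hadd := tsub_add_cancel_of_le hle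
    have := v.2
    rw [← hadd, map_add] at this
    simpa using this⟩

lemma div_exp (v : DegMon (k + 1)) (t : ℕ) (h : v.exp t ≠ 0) (i : ℕ) :
    (v.div t h).exp i = v.exp i - if t = i then 1 else 0 := by
  simp [div, exp, Finsupp.single_apply]

/-- Divide by the smallest occurring variable. -/
noncomputable def tail (v : DegMon (k + 1)) : DegMon k := v.div v.minVar v.exp_minVar_ne_zero

lemma tail_exp (v : DegMon (k + 1)) (i : ℕ) :
    v.tail.exp i = v.exp i - if v.minVar = i then 1 else 0 :=
  div_exp _ _ _ _

lemma div_le_tail (v : DegMon (k + 1)) (t : ℕ) (h : v.exp t ≠ 0) : v.div t h ≤ v.tail := by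
  have hle : v.minVar ≤ t := not_lt.1 fun hlt => h (v.exp_eq_zero_of_lt_minVar hlt)
  rcases hle.eq_or_lt with he | hlt
  · exact (ext_exp fun i => by rw [div_exp, tail_exp, he]).le
  · refine (lt_iff.2 ⟨t, ?_, ?_⟩).le
    · intro j hj
      rw [div_exp, tail_exp, if_neg (by omega), if_neg (by omega)]
    · rw [div_exp, tail_exp, if_pos rfl, if_neg (by omega)]
      omega

lemma tail_shift (v : DegMon (k + 1)) : v.shift.tail = v.tail.shift := by
  have hm : v.shift.minVar = v.minVar + 1 := by
    apply minVar_eq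
    · simpa using v.exp_minVar_ne_zero
    · intro j hj
      rcases j with _ | j
      · simp
      · simpa using v.exp_eq_zero_of_lt_minVar (by omega)
  refine ext_exp fun i => ?_
  rw [tail_exp, hm]
  rcases i with _ | i
  · simp
  · rw [shift_exp_succ, shift_exp_succ, tail_exp]
    simp

lemma degree_split (v : DegMon k) (i N : ℕ) (hN : ∀ j, N ≤ j → v.exp j = 0) (hi : i < N) :
    k = ∑ j ∈ Finset.range i, v.exp j + v.exp i + ∑ j ∈ Finset.Ico (i + 1) N, v.exp j := by
  rw [← Finset.sum_range_succ, Finset.sum_range_add_sum_Ico _ (by omega)]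
  refine v.2.symm.trans ?_
  rw [Finsupp.degree_apply]
  refine Finset.sum_subset ?_ ?_
  · intro j hj
    rw [Finset.mem_range]
    by_contra h
    exact (Finsupp.mem_support_iff.1 hj) (hN j (by omega))
  · intro j _ hj
    exact Finsupp.notMem_support_iff.1 hj

lemma exists_bound (v : DegMon k) : ∃ N, ∀ j, N ≤ j → v.exp j = 0 := by
  refine ⟨(ofColex v.1).support.sup id + 1, fun j hj => ?_⟩
  by_contra h
  have : j ≤ (ofColex v.1).support.sup id :=
    Finset.le_sup (f := id) (Finsupp.mem_support_iff.2 h)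
  omega

lemma cons_le_iff (v : DegMon k) (u : DegMon (k + 1)) : v.cons ≤ u ↔ v ≤ u.tail := by
  constructor
  · intro h
    by_contra hlt
    rw [not_le] at hlt
    obtain ⟨i, h1, h2⟩ := lt_iff.1 hlt
    rcases lt_or_ge u.minVar i with hi | hi
    · refine not_lt.2 h (lt_iff.2 ⟨i, ?_, ?_⟩)
      · intro j hj
        have := h1 j hj
        rw [tail_exp, if_neg (by omega)] at this
        obtain ⟨j, rfl⟩ : ∃ l, j = l + 1 := ⟨j - 1, by omega⟩
        simpa using this
      · rw [tail_exp, if_neg (by omega)] at h2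
        obtain ⟨i, rfl⟩ : ∃ l, i = l + 1 := ⟨i - 1, by omega⟩
        simpa using h2
    · obtain ⟨N, hN⟩ := v.exists_bound
      obtain ⟨M, hM⟩ := u.tail.exists_bound
      have e1 := v.degree_split i (max (max N M) (i + 1)) (fun j hj => hN j (by omega)) (by omega)
      have e2 := u.tail.degree_split i (max (max N M) (i + 1)) (fun j hj => hM j (by omega))
        (by omega)
      have e3 : ∑ j ∈ Finset.range i, u.tail.exp j = 0 := by
        refine Finset.sum_eq_zero fun j hj => ?_
        rw [tail_exp, u.exp_eq_zero_of_lt_minVar (by have := Finset.mem_range.1 hj; omega)]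
        simp
      have e4 : ∑ j ∈ Finset.Ico (i + 1) (max (max N M) (i + 1)), u.tail.exp j
          = ∑ j ∈ Finset.Ico (i + 1) (max (max N M) (i + 1)), v.exp j :=
        Finset.sum_congr rfl fun j hj => h1 j (by have := Finset.mem_Ico.1 hj; omega)
      omega
  · intro h
    refine (cons_strictMono.monotone h).trans ?_
    rcases Nat.eq_zero_or_pos u.minVar with h0 | h0
    · refine (ext_exp fun i => ?_).le
      have hne := u.exp_minVar_ne_zero
      rcases i with _ | i
      · rw [cons_exp_zero, tail_exp, if_pos h0]
        rw [h0] at hne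
        omega
      · rw [cons_exp_succ, tail_exp, if_neg (by omega), Nat.sub_zero]
    · have hne := u.exp_minVar_ne_zero
      refine (lt_iff.2 ⟨u.minVar, ?_, ?_⟩).le
      · intro j hj
        obtain ⟨j, rfl⟩ : ∃ l, j = l + 1 := ⟨j - 1, by omega⟩
        rw [cons_exp_succ, tail_exp, if_neg (by omega), Nat.sub_zero]
      · obtain ⟨l, hl⟩ : ∃ l, u.minVar = l + 1 := ⟨u.minVar - 1, by omega⟩
        have := tail_exp u (l + 1)
        rw [hl] at hne
        rw [hl, cons_exp_succ, tail_exp, if_pos hl]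
        omega

instance infinite_succ : Infinite (DegMon (k + 1)) := by
  refine Infinite.of_injective
    (fun i : ℕ => (⟨toColex (Finsupp.single i (k + 1)), by simp⟩ : DegMon (k + 1))) ?_
  intro i j h
  have := congrArg (fun v : DegMon (k + 1) => v.exp i) h
  by_contra hne
  simp [exp, Ne.symm hne] at this

lemma exp_le (v : DegMon k) (i : ℕ) : v.exp i ≤ k := by
  have : v.exp i ≤ (ofColex v.1).degree := Finsupp.le_degree i _
  rwa [v.2] at this

lemma finite_of_bound (N : ℕ) : {w : DegMon k | ∀ j, N ≤ j → w.exp j = 0}.Finite := by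
  have : Set.InjOn (fun (w : DegMon k) (i : Fin N) => (⟨w.exp i, by
      have := w.exp_le i; omega⟩ : Fin (k + 1))) {w : DegMon k | ∀ j, N ≤ j → w.exp j = 0} := by
    intro v hv w hw h
    refine ext_exp fun i => ?_
    rcases lt_or_ge i N with hi | hi
    · exact congrArg Fin.val (congrFun h ⟨i, hi⟩)
    · rw [hv i hi, hw i hi]
  exact Set.Finite.of_finite_image (Set.toFinite _) this

lemma exp_eq_zero_of_le {v w : DegMon k} (h : w ≤ v) {N : ℕ} (hN : ∀ j, N ≤ j → v.exp j = 0)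
    (j : ℕ) (hj : N ≤ j) : w.exp j = 0 := by
  rcases h.eq_or_lt with rfl | h
  · exact hN j hj
  · obtain ⟨i, h1, h2⟩ := lt_iff.1 h
    rcases lt_or_ge i j with hi | hi
    · rw [h1 j hi, hN j hj]
    · rw [hN i (by omega)] at h2
      omega

lemma finite_Iio (v : DegMon k) : (Set.Iio v).Finite := by
  obtain ⟨N, hN⟩ := v.exists_bound
  exact (finite_of_bound N).subset fun w hw => exp_eq_zero_of_le (le_of_lt hw) hN

/-- The order isomorphism between monomials of positive degree and the natural numbers. -/
noncomputable def rank : DegMon (k + 1) ≃o ℕ := (nonempty_orderIso_nat finite_Iio).some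

end DegMon

namespace DegMon

variable {k : ℕ}

lemma exp_add_exp_le (v : DegMon k) {i j : ℕ} (h : i ≠ j) : v.exp i + v.exp j ≤ k := by
  obtain ⟨N, hN⟩ := v.exists_bound
  have e := v.degree_split (max i j) (max N (max i j + 1)) (fun l hl => hN l (by omega)) (by omega)
  have hle : v.exp (min i j) ≤ ∑ l ∈ Finset.range (max i j), v.exp l :=
    Finset.single_le_sum (fun _ _ => Nat.zero_le _) (Finset.mem_range.2 (by omega))
  rcases lt_or_gt_of_ne h with h1 | h1
  · rw [max_eq_right h1.le] at e hle
    rw [min_eq_left h1.le] at hle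
    omega
  · rw [max_eq_left h1.le] at e hle
    rw [min_eq_right h1.le] at hle
    omega

lemma shift_le_of_lt {v w : DegMon 1} (h : v < w) : v.shift ≤ w := by
  by_contra hlt
  rw [not_le] at hlt
  obtain ⟨i, h1, h2⟩ := lt_iff.1 h
  obtain ⟨j, h3, h4⟩ := lt_iff.1 hlt
  rcases j with _ | l
  · simp at h4
  rw [shift_exp_succ] at h4
  have hvl := v.exp_le l
  have hwi := w.exp_le i
  rcases lt_trichotomy i l with h5 | h5 | h5
  · have := h1 l h5
    have := w.exp_add_exp_le h5.ne
    omega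
  · subst h5
    omega
  · rcases Nat.lt_or_ge (l + 1) i with h6 | h6
    · obtain ⟨i, rfl⟩ : ∃ r, i = r + 1 := ⟨i - 1, by omega⟩
      have := h3 _ h6
      rw [shift_exp_succ] at this
      have := v.exp_add_exp_le (show l ≠ i by omega)
      omega
    · obtain rfl : i = l + 1 := by omega
      omega

lemma lt_shift (v : DegMon (k + 1)) : v < v.shift := by
  classical
  have hN := Nat.find_spec v.exists_bound
  set N := Nat.find v.exists_bound with hNdef
  have hpos : N ≠ 0 := fun h => v.exp_minVar_ne_zero (hN _ (by omega))
  obtain ⟨M, hM⟩ : ∃ M, N = M + 1 := ⟨N - 1, by omega⟩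
  refine lt_iff.2 ⟨N, ?_, ?_⟩
  · intro j hj
    obtain ⟨j, rfl⟩ : ∃ r, j = r + 1 := ⟨j - 1, by omega⟩
    rw [shift_exp_succ, hN _ (by omega), hN _ (by omega)]
  · have hmin := Nat.find_min v.exists_bound (m := M) (by omega)
    push Not at hmin
    obtain ⟨j, hj, hj'⟩ := hmin
    have hjM : j = M := by
      by_contra hne
      exact hj' (hN j (by omega))
    subst hjM
    rw [hN _ le_rfl, hM, shift_exp_succ]
    omega

end DegMon

open DegMon

/-- The map on ranks induced by `DegMon.shift`, in degree `k + 1`. -/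
noncomputable def shiftRank (k q : ℕ) : ℕ := rank (k := k) (shift (rank.symm q))

/-- The map on ranks induced by `DegMon.cons`, from degree `k + 1` to degree `k + 2`. It is the
maximal growth function of Macaulay. -/
noncomputable def consRank (k q : ℕ) : ℕ := rank (k := k + 1) (cons (k := k + 1) (rank.symm q))

/-- The map on ranks induced by `DegMon.tail`, from degree `k + 2` to degree `k + 1`. -/
noncomputable def tailRank (k q : ℕ) : ℕ :=
  rank (k := k) (tail (k := k + 1) (rank.symm q))

/-- The bound of Green on codimensions of general hyperplane sections in degree `k + 1`. -/
noncomputable def greenBound (k c : ℕ) : ℕ := countRange (shiftRank k) c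

lemma shiftRank_strictMono (k : ℕ) : StrictMono (shiftRank k) :=
  rank.strictMono.comp (shift_strictMono.comp rank.symm.strictMono)

lemma consRank_strictMono (k : ℕ) : StrictMono (consRank k) :=
  rank.strictMono.comp (cons_strictMono.comp rank.symm.strictMono)

lemma consRank_le_iff (k c q : ℕ) : consRank k c ≤ q ↔ c ≤ tailRank k q := by
  rw [consRank, tailRank, ← OrderIso.le_symm_apply, cons_le_iff, ← OrderIso.symm_apply_le]

lemma lt_consRank_iff (k c q : ℕ) : q < consRank k c ↔ tailRank k q < c := by
  rw [← not_le, consRank_le_iff, not_le]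

lemma tailRank_shiftRank (k q : ℕ) :
    tailRank k (shiftRank (k + 1) q) = shiftRank k (tailRank k q) := by
  simp [tailRank, shiftRank, tail_shift]

lemma mem_range_shiftRank_iff (k p : ℕ) :
    p ∈ Set.range (shiftRank (k + 1)) ↔ p ∉ Set.range (consRank k) := by
  have h1 : p ∈ Set.range (shiftRank (k + 1)) ↔
      rank.symm p ∈ Set.range (shift (k := k + 2)) := by
    constructor
    · rintro ⟨q, rfl⟩
      exact ⟨rank.symm q, by simp [shiftRank]⟩
    · rintro ⟨v, hv⟩
      exact ⟨rank v, by simp [shiftRank, hv]⟩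
  have h2 : p ∈ Set.range (consRank k) ↔ rank.symm p ∈ Set.range (cons (k := k + 1)) := by
    constructor
    · rintro ⟨q, rfl⟩
      exact ⟨rank.symm q, by simp [consRank]⟩
    · rintro ⟨v, hv⟩
      exact ⟨rank v, by simp [consRank, hv]⟩
  rw [h1, h2, mem_range_shift, mem_range_cons, not_not]

lemma greenBound_add_countRange (k c : ℕ) :
    greenBound (k + 1) c + countRange (consRank k) c = c :=
  countRange_add_countRange (mem_range_shiftRank_iff k) c

lemma lt_greenBound_iff (k q c : ℕ) : q < greenBound k c ↔ shiftRank k q < c :=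
  lt_countRange_iff (shiftRank_strictMono k) q c

lemma greenBound_le_iff (k q c : ℕ) : greenBound k c ≤ q ↔ c ≤ shiftRank k q :=
  countRange_le_iff (shiftRank_strictMono k) q c

lemma lt_shiftRank (k q : ℕ) : q < shiftRank k q := by
  have := lt_shift (rank.symm q : DegMon (k + 1))
  rwa [OrderIso.symm_apply_lt] at this

lemma greenBound_lt {k c : ℕ} (hc : 0 < c) : greenBound k c < c := by
  have : greenBound k c ≤ c - 1 := by
    rw [greenBound_le_iff]
    have := lt_shiftRank k (c - 1)
    omega
  omega

lemma countRange_consRank_succ (k q : ℕ) :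
    countRange (consRank k) (q + 1) = tailRank k q + 1 := by
  refine eq_of_forall_lt_iff fun n => ?_
  rw [lt_countRange_iff (consRank_strictMono k), Nat.lt_succ_iff, consRank_le_iff, Nat.lt_succ_iff]

lemma countRange_eq_self {f : ℕ → ℕ} (hf : StrictMono f) (q : ℕ) : countRange f (f q) = q :=
  eq_of_forall_lt_iff fun n => by rw [lt_countRange_iff hf, hf.lt_iff_lt]

lemma shiftRank_succ (k q : ℕ) :
    shiftRank (k + 1) q = q + 1 + shiftRank k (tailRank k q) := by
  have h1 := greenBound_add_countRange k (shiftRank (k + 1) q)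
  rw [greenBound, countRange_eq_self (shiftRank_strictMono _)] at h1
  have h2 : countRange (consRank k) (shiftRank (k + 1) q)
      = shiftRank k (tailRank k q) + 1 := by
    refine eq_of_forall_lt_iff fun n => ?_
    rw [lt_countRange_iff (consRank_strictMono k), Nat.lt_succ_iff, ← tailRank_shiftRank,
      ← consRank_le_iff]
    refine ⟨le_of_lt, fun h => lt_of_le_of_ne h fun he => ?_⟩
    exact (mem_range_shiftRank_iff k _).1 ⟨q, rfl⟩ ⟨n, he⟩
  omega

lemma le_greenBound_succ {k a c : ℕ} (h : c < a)
    (h' : c ≤ greenBound k (a - c) + greenBound (k + 1) c) : c ≤ greenBound (k + 1) a := by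
  rcases c with _ | q
  · exact Nat.zero_le _
  · rw [Nat.succ_le_iff, lt_greenBound_iff]
    by_contra hle
    rw [not_lt, shiftRank_succ] at hle
    have h1 : greenBound k (a - (q + 1)) ≤ tailRank k q := by
      rw [greenBound_le_iff]
      omega
    have h2 := greenBound_add_countRange k (q + 1)
    rw [countRange_consRank_succ] at h2
    omega

lemma le_greenBound_zero {a c : ℕ} (h : c < a) : c ≤ greenBound 0 a := by
  rcases c with _ | q
  · exact Nat.zero_le _
  · rw [Nat.succ_le_iff, lt_greenBound_iff]
    have hlt : (rank.symm q : DegMon 1) < rank.symm (q + 1) :=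
      rank.symm.strictMono (Nat.lt_succ_self q)
    have := shift_le_of_lt hlt
    rw [OrderIso.le_symm_apply] at this
    exact lt_of_le_of_lt this h

lemma le_consRank {k c e : ℕ} (h : e ≤ c + greenBound (k + 1) e) : e ≤ consRank k c := by
  rw [← countRange_le_iff (consRank_strictMono k)]
  have := greenBound_add_countRange k e
  omega

lemma greenBound_consRank_add (k c : ℕ) :
    greenBound (k + 1) (consRank k c) + c = consRank k c := by
  have := greenBound_add_countRange k (consRank k c)
  rwa [countRange_eq_self (consRank_strictMono k)] at this

lemma consRank_greenBound (k c : ℕ) :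
    consRank k (greenBound k c) = greenBound (k + 1) (consRank k c) := by
  refine eq_of_forall_lt_iff fun q => ?_
  rw [lt_consRank_iff, lt_greenBound_iff, lt_greenBound_iff, lt_consRank_iff, tailRank_shiftRank]

lemma rank_lt_consRank_iff {k : ℕ} (u : DegMon (k + 2)) (c : ℕ) :
    rank u < consRank k c ↔ ∀ t h, rank (u.div t h) < c := by
  rw [lt_consRank_iff, tailRank, OrderIso.symm_apply_apply]
  constructor
  · intro h t ht
    exact lt_of_le_of_lt (rank.monotone (div_le_tail u t ht)) h
  · intro h
    exact h _ _

section Generic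

variable {V V' : Type} [AddCommGroup V] [Module K V] [AddCommGroup V'] [Module K V']

lemma finrank_quotient_eq_add [FiniteDimensional K V'] (W : Submodule K V') (A : V →ₗ[K] V') :
    Module.finrank K (V' ⧸ W) = Module.finrank K (V' ⧸ (W ⊔ LinearMap.range A)) +
      Module.finrank K (V ⧸ W.comap A) := by
  have e1 := (Submodule.quotientQuotientEquivQuotientSup W (LinearMap.range A)).finrank_eq
  have e2 := (LinearMap.quotKerEquivRange (W.mkQ ∘ₗ A)).finrank_eq
  rw [LinearMap.ker_comp, Submodule.ker_mkQ, LinearMap.range_comp] at e2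
  rw [← e1, e2, Submodule.finrank_quotient_add_finrank]

lemma finite_finrank_range_lt [FiniteDimensional K V] (A B : V →ₗ[K] V') :
    {t : K | Module.finrank K (LinearMap.range (A + t • B))
      < Module.finrank K (LinearMap.range A)}.Finite := by
  obtain ⟨C, hC⟩ := Submodule.exists_isCompl (LinearMap.ker A)
  have hinj : LinearMap.ker (A ∘ₗ C.subtype) = ⊥ := by
    rw [LinearMap.ker_eq_bot']
    intro c hc
    exact Subtype.ext (Submodule.disjoint_def.1 hC.disjoint c.1 hc c.2)
  obtain ⟨g, hg⟩ := LinearMap.exists_leftInverse_of_injective _ hinj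
  have hcard : Module.finrank K C = Module.finrank K (LinearMap.range A) := by
    have h1 := LinearMap.finrank_range_add_finrank_ker A
    have h2 := Submodule.finrank_add_eq_of_isCompl hC
    omega
  let M : Module.End K C := g ∘ₗ B ∘ₗ C.subtype
  refine ((Module.End.finite_hasEigenvalue M).image (fun μ => -μ⁻¹)).subset ?_
  intro t ht
  by_contra hne
  refine (not_le.2 (Set.mem_ofPred_eq ▸ ht)) ?_
  rw [← hcard]
  have hinj' : Function.Injective ((A + t • B) ∘ₗ C.subtype) := by
    rw [← LinearMap.ker_eq_bot, LinearMap.ker_eq_bot']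
    intro c hc
    by_contra hc0
    have h1 : c + t • M c = 0 := by
      have h2 := congrArg g hc
      have h3 := LinearMap.congr_fun hg c
      simp only [LinearMap.comp_apply, LinearMap.add_apply, LinearMap.smul_apply, map_add,
        map_smul, map_zero, LinearMap.id_apply] at h2 h3
      rw [h3] at h2
      exact h2
    have ht0 : t ≠ 0 := by
      rintro rfl
      simp [hc0] at h1
    refine hne ⟨-t⁻¹, ?_, by simp⟩
    refine Module.End.hasEigenvalue_of_hasEigenvector (x := c) ⟨?_, hc0⟩
    rw [Module.End.mem_eigenspace_iff]
    have : t • M c = -c := by rw [eq_neg_iff_add_eq_zero, add_comm, h1]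
    rw [← inv_smul_smul₀ ht0 (M c), this]
    simp
  rw [← LinearMap.finrank_range_of_inj hinj']
  exact Submodule.finrank_mono (LinearMap.range_comp_le_range _ _)

variable [FiniteDimensional K V] [FiniteDimensional K V']

lemma finite_codim_lt (W : Submodule K V') (A B : V →ₗ[K] V') :
    {t : K | Module.finrank K (V' ⧸ (W ⊔ LinearMap.range A))
      < Module.finrank K (V' ⧸ (W ⊔ LinearMap.range (A + t • B)))}.Finite := by
  refine (finite_finrank_range_lt (W.mkQ ∘ₗ A) (W.mkQ ∘ₗ B)).subset ?_
  intro t ht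
  rw [Set.mem_ofPred_eq] at ht ⊢
  have h1 := finrank_quotient_eq_add W A
  have h2 := finrank_quotient_eq_add W (A + t • B)
  have e1 := (LinearMap.quotKerEquivRange (W.mkQ ∘ₗ A)).finrank_eq
  have e2 := (LinearMap.quotKerEquivRange (W.mkQ ∘ₗ (A + t • B))).finrank_eq
  rw [LinearMap.ker_comp, Submodule.ker_mkQ] at e1 e2
  have e3 : W.mkQ ∘ₗ A + t • W.mkQ ∘ₗ B = W.mkQ ∘ₗ (A + t • B) := by
    rw [LinearMap.comp_add, LinearMap.comp_smul]
  rw [e3]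
  omega

lemma finrank_quotient_le_of_le {W W' : Submodule K V} (h : W ≤ W') :
    Module.finrank K (V ⧸ W') ≤ Module.finrank K (V ⧸ W) := by
  have h1 := W.finrank_quotient_add_finrank
  have h2 := W'.finrank_quotient_add_finrank
  have := Submodule.finrank_mono h
  omega

lemma eq_of_le_of_finrank_quotient_le {W W' : Submodule K V} (h : W ≤ W')
    (h' : Module.finrank K (V ⧸ W) ≤ Module.finrank K (V ⧸ W')) : W = W' := by
  have h1 := W.finrank_quotient_add_finrank
  have h2 := W'.finrank_quotient_add_finrank
  exact Submodule.eq_of_le_of_finrank_le h (by omega)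

end Generic

section Graded

variable {ℓ : ℕ} {E : ℕ → Type} [∀ k, AddCommGroup (E k)] [∀ k, Module K (E k)]

/-- Multiplication by the linear form with coefficients `h`. -/
def mulForm (x : Fin ℓ → ∀ k, E k →ₗ[K] E (k + 1)) (h : Fin ℓ → K) (k : ℕ) :
    E k →ₗ[K] E (k + 1) :=
  ∑ t, h t • x t k

variable {x : Fin ℓ → ∀ k, E k →ₗ[K] E (k + 1)}

lemma mulForm_apply (h : Fin ℓ → K) (k : ℕ) (e : E k) :
    mulForm x h k e = ∑ t, h t • x t k e := by
  simp [mulForm]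

lemma mulForm_add_smul (h g : Fin ℓ → K) (a : K) (k : ℕ) :
    mulForm x (h + a • g) k = mulForm x h k + a • mulForm x g k := by
  simp [mulForm, add_smul, mul_smul, Finset.sum_add_distrib, Finset.smul_sum]

lemma mulForm_mulForm
    (hcomm : ∀ s t k (e : E k), x s (k + 1) (x t k e) = x t (k + 1) (x s k e))
    (h g : Fin ℓ → K) (k : ℕ) (e : E k) :
    mulForm x h (k + 1) (mulForm x g k e) = mulForm x g (k + 1) (mulForm x h k e) := by
  simp only [mulForm_apply, map_sum, map_smul, Finset.smul_sum]
  rw [Finset.sum_comm]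
  refine Finset.sum_congr rfl fun s _ => Finset.sum_congr rfl fun t _ => ?_
  rw [hcomm, smul_comm]

lemma mulForm_single (t : Fin ℓ) (k : ℕ) : mulForm x (Pi.single t 1) k = x t k := by
  classical
  rw [mulForm, Finset.sum_eq_single t]
  · simp
  · intro s _ hs
    simp [hs]
  · simp

variable [∀ k, FiniteDimensional K (E k)]

lemma exists_common_form [Infinite K] {k j : ℕ} (W : Submodule K (E (k + 1)))
    (W' : Submodule K (E (j + 1))) (h g : Fin ℓ → K) :
    ∃ p : Fin ℓ → K,
      Module.finrank K (E (k + 1) ⧸ (W ⊔ LinearMap.range (mulForm x p k))) ≤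
        Module.finrank K (E (k + 1) ⧸ (W ⊔ LinearMap.range (mulForm x h k))) ∧
      Module.finrank K (E (j + 1) ⧸ (W' ⊔ LinearMap.range (mulForm x p j))) ≤
        Module.finrank K (E (j + 1) ⧸ (W' ⊔ LinearMap.range (mulForm x g j))) := by
  have f1 := finite_codim_lt W (mulForm x h k) (mulForm x (g - h) k)
  have f2 := (finite_codim_lt W' (mulForm x g j) (mulForm x (h - g) j)).image (fun s => 1 - s)
  obtain ⟨t, ht⟩ := (f1.union f2).exists_notMem
  simp only [Set.mem_union, not_or] at ht
  refine ⟨h + t • (g - h), ?_, ?_⟩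
  · rw [mulForm_add_smul]
    exact not_lt.1 ht.1
  · have e : h + t • (g - h) = g + (1 - t) • (h - g) := by
      ext i
      simp only [Pi.add_apply, Pi.smul_apply, Pi.sub_apply, smul_eq_mul]
      ring
    rw [e, mulForm_add_smul]
    by_contra hlt
    exact ht.2 ⟨1 - t, not_le.1 hlt, by simp⟩

lemma exists_codim_lt
    (hgen : ∀ k (e : E (k + 1)), ∃ v : Fin ℓ → E k, e = ∑ t, x t k (v t))
    {k : ℕ} (W : Submodule K (E (k + 1))) (h0 : 0 < Module.finrank K (E (k + 1) ⧸ W)) :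
    ∃ h : Fin ℓ → K, Module.finrank K (E (k + 1) ⧸ (W ⊔ LinearMap.range (mulForm x h k))) <
      Module.finrank K (E (k + 1) ⧸ W) := by
  by_contra hno
  push Not at hno
  have hW : W = ⊤ := by
    rw [eq_top_iff]
    rintro e -
    obtain ⟨v, rfl⟩ := hgen k e
    refine Submodule.sum_mem _ fun t _ => ?_
    rw [eq_of_le_of_finrank_quotient_le le_sup_left (hno (Pi.single t 1)), mulForm_single]
    exact Submodule.mem_sup_right ⟨_, rfl⟩
  subst hW
  have := Submodule.finrank_quotient_add_finrank (⊤ : Submodule K (E (k + 1)))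
  rw [finrank_top] at this
  omega

/-- Green's hyperplane restriction theorem. -/
lemma exists_codim_le_greenBound [Infinite K]
    (hcomm : ∀ s t k (e : E k), x s (k + 1) (x t k e) = x t (k + 1) (x s k e))
    (hgen : ∀ k (e : E (k + 1)), ∃ v : Fin ℓ → E k, e = ∑ t, x t k (v t))
    (k : ℕ) (W : Submodule K (E (k + 1))) :
    ∃ h : Fin ℓ → K, Module.finrank K (E (k + 1) ⧸ (W ⊔ LinearMap.range (mulForm x h k))) ≤
      greenBound k (Module.finrank K (E (k + 1) ⧸ W)) := by
  induction k with
  | zero =>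
    rcases Nat.eq_zero_or_pos (Module.finrank K (E (0 + 1) ⧸ W)) with h0 | h0
    · exact ⟨0, (finrank_quotient_le_of_le le_sup_left).trans (by omega)⟩
    · obtain ⟨h, hh⟩ := exists_codim_lt hgen W h0
      exact ⟨h, le_greenBound_zero hh⟩
  | succ k ih =>
    induction hn : Module.finrank K (E (k + 1 + 1) ⧸ W) using Nat.strong_induction_on
      generalizing W with
    | _ a ih' =>
    subst hn
    rcases Nat.eq_zero_or_pos (Module.finrank K (E (k + 1 + 1) ⧸ W)) with h0 | h0
    · exact ⟨0, (finrank_quotient_le_of_le le_sup_left).trans (by omega)⟩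
    · obtain ⟨h1, hh1⟩ := exists_codim_lt hgen W h0
      obtain ⟨h, hmin⟩ : ∃ h : Fin ℓ → K, ∀ g : Fin ℓ → K,
          Module.finrank K (E (k + 1 + 1) ⧸ (W ⊔ LinearMap.range (mulForm x h (k + 1)))) ≤
          Module.finrank K (E (k + 1 + 1) ⧸ (W ⊔ LinearMap.range (mulForm x g (k + 1)))) := by
        refine ⟨Function.argmin (fun h : Fin ℓ → K => Module.finrank K
          (E (k + 1 + 1) ⧸ (W ⊔ LinearMap.range (mulForm x h (k + 1))))), fun g => ?_⟩
        exact Function.argmin_le (fun h : Fin ℓ → K => Module.finrank K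
          (E (k + 1 + 1) ⧸ (W ⊔ LinearMap.range (mulForm x h (k + 1))))) g
      have hlt := (hmin h1).trans_lt hh1
      obtain ⟨p, hp⟩ := ih' _ hlt (W ⊔ LinearMap.range (mulForm x h (k + 1))) rfl
      obtain ⟨q, hq⟩ := ih (W.comap (mulForm x h (k + 1)))
      obtain ⟨g, hg1, hg2⟩ := exists_common_form (x := x)
        (W ⊔ LinearMap.range (mulForm x h (k + 1))) (W.comap (mulForm x h (k + 1))) p q
      refine ⟨h, le_greenBound_succ hlt ?_⟩
      have e1 := finrank_quotient_eq_add W (mulForm x h (k + 1))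
      have e2 := finrank_quotient_eq_add (W ⊔ LinearMap.range (mulForm x g (k + 1)))
        (mulForm x h (k + 1))
      have e3 : Module.finrank K (E (k + 1) ⧸
          (W ⊔ LinearMap.range (mulForm x g (k + 1))).comap (mulForm x h (k + 1))) ≤
          Module.finrank K (E (k + 1) ⧸
            (W.comap (mulForm x h (k + 1)) ⊔ LinearMap.range (mulForm x g k))) := by
        refine finrank_quotient_le_of_le (sup_le (Submodule.comap_mono le_sup_left) ?_)
        rintro _ ⟨e, rfl⟩
        rw [Submodule.mem_comap, mulForm_mulForm hcomm]
        exact Submodule.mem_sup_right ⟨_, rfl⟩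
      rw [sup_right_comm] at e2
      have e4 := hmin g
      have e5 : Module.finrank K (E (k + 1 + 1) ⧸ W) -
          Module.finrank K (E (k + 1 + 1) ⧸ (W ⊔ LinearMap.range (mulForm x h (k + 1)))) =
          Module.finrank K (E (k + 1) ⧸ W.comap (mulForm x h (k + 1))) := by omega
      rw [e5]
      omega

/-- Macaulay's bound on the growth of Hilbert functions. -/
lemma codim_le_consRank [Infinite K]
    (hcomm : ∀ s t k (e : E k), x s (k + 1) (x t k e) = x t (k + 1) (x s k e))
    (hgen : ∀ k (e : E (k + 1)), ∃ v : Fin ℓ → E k, e = ∑ t, x t k (v t))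
    (k : ℕ) (W : Submodule K (E (k + 1))) (W' : Submodule K (E (k + 1 + 1)))
    (hW : ∀ t, ∀ e ∈ W, x t (k + 1) e ∈ W') :
    Module.finrank K (E (k + 1 + 1) ⧸ W') ≤
      consRank k (Module.finrank K (E (k + 1) ⧸ W)) := by
  obtain ⟨h, hh⟩ := exists_codim_le_greenBound hcomm hgen (k + 1) W'
  refine le_consRank ?_
  have e1 := finrank_quotient_eq_add W' (mulForm x h (k + 1))
  have e2 : Module.finrank K (E (k + 1) ⧸ W'.comap (mulForm x h (k + 1))) ≤
      Module.finrank K (E (k + 1) ⧸ W) := by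
    refine finrank_quotient_le_of_le fun e he => ?_
    rw [Submodule.mem_comap, mulForm_apply]
    exact Submodule.sum_mem _ fun t _ => Submodule.smul_mem _ _ (hW t e he)
  omega

end Graded

section Koszul

variable {ℓ : ℕ}

/-- The sign of the variable `t` relative to the set `s` in the Koszul complex. -/
def koszulSign (K : Type) [Field K] (t : Fin ℓ) (s : Finset (Fin ℓ)) : K :=
  (-1) ^ (s.filter (fun u => u < t)).card

lemma koszulSign_mul_self (t : Fin ℓ) (s : Finset (Fin ℓ)) :
    koszulSign K t s * koszulSign K t s = 1 := by
  rw [koszulSign, ← mul_pow]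
  simp

lemma koszulSign_insert {t u : Fin ℓ} {s : Finset (Fin ℓ)} (ht : t ∉ s) :
    koszulSign K u (insert t s) = if t < u then -koszulSign K u s else koszulSign K u s := by
  rw [koszulSign, koszulSign, Finset.filter_insert]
  split_ifs with h
  · rw [Finset.card_insert_of_notMem (by simp [ht]), pow_succ]
    ring
  · rfl

lemma koszulSign_swap {t u : Fin ℓ} {s : Finset (Fin ℓ)} (ht : t ∉ s) (hu : u ∉ s)
    (htu : t ≠ u) :
    koszulSign K u (insert t s) * koszulSign K t (insert u s) =
      -(koszulSign K t s * koszulSign K u s) := by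
  rw [koszulSign_insert ht, koszulSign_insert hu]
  rcases lt_or_gt_of_ne htu with h | h
  · rw [if_pos h, if_neg h.asymm]
    ring
  · rw [if_neg h.asymm, if_pos h]
    ring

lemma koszulSign_swap' {t u : Fin ℓ} {s : Finset (Fin ℓ)} (ht : t ∉ s) (hu : u ∉ s)
    (htu : t ≠ u) :
    koszulSign K t s * koszulSign K u (insert t s) =
      -(koszulSign K u s * koszulSign K t (insert u s)) := by
  rw [koszulSign_insert ht, koszulSign_insert hu]
  rcases lt_or_gt_of_ne htu with h | h
  · rw [if_pos h, if_neg h.asymm]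
    ring
  · rw [if_neg h.asymm, if_pos h]
    ring

variable {E : ℕ → Type} [∀ k, AddCommGroup (E k)] [∀ k, Module K (E k)]

/-- The Koszul differential on chains indexed by all sets of variables. -/
def bdry (x : Fin ℓ → ∀ k, E k →ₗ[K] E (k + 1)) {k : ℕ} (z : Finset (Fin ℓ) → E k)
    (s : Finset (Fin ℓ)) : E (k + 1) :=
  ∑ t ∈ sᶜ, koszulSign K t s • x t k (z (insert t s))

/-- Exterior multiplication by the basis vector `t`. -/
def extMul {k : ℕ} (t : Fin ℓ) (z : Finset (Fin ℓ) → E k) (s : Finset (Fin ℓ)) : E k :=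
  if t ∈ s then koszulSign K t (s.erase t) • z (s.erase t) else 0

variable {x : Fin ℓ → ∀ k, E k →ₗ[K] E (k + 1)}

lemma bdry_add {k : ℕ} (z w : Finset (Fin ℓ) → E k) (s : Finset (Fin ℓ)) :
    bdry x (z + w) s = bdry x z s + bdry x w s := by
  simp [bdry, Finset.sum_add_distrib]

lemma bdry_sum_smul {k : ℕ} (h : Fin ℓ → K) (z : Fin ℓ → Finset (Fin ℓ) → E k)
    (s : Finset (Fin ℓ)) :
    bdry x (∑ t, h t • z t) s = ∑ t, h t • bdry x (z t) s := by
  simp only [bdry, Finset.sum_apply, Pi.smul_apply, map_sum, map_smul, Finset.smul_sum]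
  rw [Finset.sum_comm]
  refine Finset.sum_congr rfl fun t _ => Finset.sum_congr rfl fun u _ => ?_
  rw [smul_comm]

lemma bdry_bdry
    (hcomm : ∀ s t k (e : E k), x s (k + 1) (x t k e) = x t (k + 1) (x s k e))
    {k : ℕ} (z : Finset (Fin ℓ) → E k) (s : Finset (Fin ℓ)) :
    bdry x (bdry x z) s = 0 := by
  simp only [bdry, map_sum, map_smul, Finset.smul_sum, smul_smul]
  rw [Finset.sum_sigma']
  refine Finset.sum_involution (fun p _ => ⟨p.2, p.1⟩) ?_ ?_ ?_ ?_
  · rintro ⟨t, u⟩ h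
    simp only [Finset.mem_sigma, Finset.mem_compl, Finset.mem_insert, not_or] at h
    dsimp only
    rw [koszulSign_swap' h.1 h.2.2 (Ne.symm h.2.1), hcomm t u, Finset.insert_comm, neg_smul,
      neg_add_cancel]
  · rintro ⟨t, u⟩ h - he
    simp only [Finset.mem_sigma, Finset.mem_compl, Finset.mem_insert, not_or] at h
    exact h.2.1 (congrArg Sigma.fst he)
  · rintro ⟨t, u⟩ h
    simp only [Finset.mem_sigma, Finset.mem_compl, Finset.mem_insert, not_or] at h ⊢
    exact ⟨h.2.2, Ne.symm h.2.1, h.1⟩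
  · rintro ⟨t, u⟩ h
    rfl

lemma bdry_extMul_add {k : ℕ} (t : Fin ℓ) (z : Finset (Fin ℓ) → E k) (s : Finset (Fin ℓ)) :
    bdry x (extMul (K := K) t z) s + extMul (K := K) t (bdry x z) s = x t k (z s) := by
  by_cases ht : t ∈ s
  · rw [extMul, if_pos ht, bdry, bdry]
    have hc : (s.erase t)ᶜ = insert t sᶜ := by
      ext u
      simp only [Finset.mem_compl, Finset.mem_erase, Finset.mem_insert]
      tauto
    rw [hc, Finset.sum_insert (by simpa using ht), smul_add, smul_smul, koszulSign_mul_self,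
      one_smul, Finset.insert_erase ht, Finset.smul_sum]
    rw [add_left_comm, ← Finset.sum_add_distrib, Finset.sum_eq_zero, add_zero]
    intro u hu
    have hus : u ∉ s := by simpa using hu
    have hut : u ≠ t := fun h => hus (h ▸ ht)
    rw [extMul, if_pos (Finset.mem_insert_of_mem ht), Finset.erase_insert_of_ne hut,
      map_smul, smul_smul, smul_smul]
    have h1 : s = insert t (s.erase t) := (Finset.insert_erase ht).symm
    have h2 : koszulSign K u s * koszulSign K t (insert u (s.erase t)) =
        -(koszulSign K t (s.erase t) * koszulSign K u (s.erase t)) := by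
      conv_lhs => rw [h1]
      rw [Finset.erase_insert (Finset.notMem_erase t s)]
      exact koszulSign_swap (Finset.notMem_erase t s) (fun h => hus (Finset.mem_of_mem_erase h))
        hut.symm
    rw [h2, neg_smul, neg_add_cancel]
  · rw [extMul, if_neg ht, add_zero, bdry, Finset.sum_eq_single t]
    · rw [extMul, if_pos (Finset.mem_insert_self t s), Finset.erase_insert ht, map_smul, smul_smul,
        koszulSign_mul_self, one_smul]
    · intro u hu hut
      rw [extMul, if_neg, map_zero, smul_zero]
      simp [ht, Ne.symm hut]
    · intro h
      exact absurd (by simpa using ht) h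

lemma bdry_mem {k : ℕ} {W : Submodule K (E k)} {W' : Submodule K (E (k + 1))}
    (hW : ∀ t, ∀ e ∈ W, x t k e ∈ W') {z : Finset (Fin ℓ) → E k} (hz : ∀ s, z s ∈ W)
    (s : Finset (Fin ℓ)) : bdry x z s ∈ W' :=
  Submodule.sum_mem _ fun _ _ => Submodule.smul_mem _ _ (hW _ _ (hz _))

/-- Maximal growth forces exactness of the Koszul complex. -/
lemma exists_sub_bdry_mem [∀ k, FiniteDimensional K (E k)] [Infinite K]
    (hcomm : ∀ s t k (e : E k), x s (k + 1) (x t k e) = x t (k + 1) (x s k e))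
    (hgen : ∀ k (e : E (k + 1)), ∃ v : Fin ℓ → E k, e = ∑ t, x t k (v t))
    (k : ℕ) (W : Submodule K (E (k + 1))) (W' : Submodule K (E (k + 1 + 1)))
    (hW : ∀ t, ∀ e ∈ W, x t (k + 1) e ∈ W')
    (hgrow : consRank k (Module.finrank K (E (k + 1) ⧸ W)) ≤ Module.finrank K (E (k + 1 + 1) ⧸ W'))
    (z : Finset (Fin ℓ) → E (k + 1)) (hz : ∀ s, bdry x z s ∈ W') :
    ∃ w : Finset (Fin ℓ) → E k, ∀ s, z s - bdry x w s ∈ W := by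
  induction hn : Module.finrank K (E (k + 1) ⧸ W) using Nat.strong_induction_on
    generalizing W W' with
  | _ c ih =>
  subst hn
  rcases Nat.eq_zero_or_pos (Module.finrank K (E (k + 1) ⧸ W)) with h0 | h0
  · have hW : W = ⊤ := eq_of_le_of_finrank_quotient_le le_top (by omega)
    exact ⟨0, fun s => hW ▸ Submodule.mem_top⟩
  · obtain ⟨p, hp⟩ := exists_codim_le_greenBound hcomm hgen k W
    obtain ⟨q, hq⟩ := exists_codim_le_greenBound hcomm hgen (k + 1) W'
    obtain ⟨h, hh1, hh2⟩ := exists_common_form (x := x) W W' p q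
    have hWh : ∀ t, ∀ e ∈ W ⊔ LinearMap.range (mulForm x h k),
        x t (k + 1) e ∈ W' ⊔ LinearMap.range (mulForm x h (k + 1)) := by
      intro t e he
      obtain ⟨e1, he1, _, ⟨e2, rfl⟩, rfl⟩ := Submodule.mem_sup.1 he
      rw [map_add]
      refine Submodule.add_mem_sup (hW t e1 he1) ⟨x t k e2, ?_⟩
      rw [← mulForm_single (x := x) t (k + 1), ← mulForm_single (x := x) t k,
        mulForm_mulForm hcomm]
    have f1 := finrank_quotient_eq_add W' (mulForm x h (k + 1))
    have hle : W ≤ W'.comap (mulForm x h (k + 1)) := by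
      intro e he
      rw [Submodule.mem_comap, mulForm_apply]
      exact Submodule.sum_mem _ fun t _ => Submodule.smul_mem _ _ (hW t e he)
    have f2 := finrank_quotient_le_of_le hle
    have f3 := codim_le_consRank hcomm hgen k W W' hW
    have f4 : Module.finrank K (E (k + 1 + 1) ⧸ W') =
      consRank k (Module.finrank K (E (k + 1) ⧸ W)) := le_antisymm f3 hgrow
    have f5 := greenBound_consRank_add k (Module.finrank K (E (k + 1) ⧸ W))
    rw [f4] at hq f1
    have hcolon : W = W'.comap (mulForm x h (k + 1)) :=
      eq_of_le_of_finrank_quotient_le hle (by omega)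
    have hlt : Module.finrank K (E (k + 1) ⧸ (W ⊔ LinearMap.range (mulForm x h k))) <
        Module.finrank K (E (k + 1) ⧸ W) :=
      (hh1.trans hp).trans_lt (greenBound_lt h0)
    have hgrow' : consRank k
          (Module.finrank K (E (k + 1) ⧸ (W ⊔ LinearMap.range (mulForm x h k)))) ≤
        Module.finrank K (E (k + 1 + 1) ⧸ (W' ⊔ LinearMap.range (mulForm x h (k + 1)))) := by
      refine ((consRank_strictMono k).monotone (hh1.trans hp)).trans ?_
      rw [consRank_greenBound]
      omega
    obtain ⟨w, hw⟩ := ih _ hlt _ _ hWh hgrow' (fun s => Submodule.mem_sup_left (hz s)) rfl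
    have hdec : ∀ s, ∃ (y : E (k + 1)) (u : E k), y ∈ W ∧
        z s = bdry x w s + mulForm x h k u + y := by
      intro s
      obtain ⟨y, hy, _, ⟨u, rfl⟩, he⟩ := Submodule.mem_sup.1 (hw s)
      refine ⟨y, u, hy, ?_⟩
      rw [add_assoc, add_comm (mulForm x h k u), he]
      abel
    choose y u hy hzs using hdec
    have hz' : z = bdry x w + (fun s => mulForm x h k (u s)) + y := funext hzs
    have hbu : ∀ s, bdry x (fun s => mulForm x h k (u s)) s
        = mulForm x h (k + 1) (bdry x u s) := by
      intro s
      simp only [bdry, map_sum, map_smul]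
      refine Finset.sum_congr rfl fun t _ => ?_
      rw [← mulForm_single (x := x) t (k + 1), ← mulForm_single (x := x) t k,
        mulForm_mulForm hcomm]
    have hdu : ∀ s, bdry x u s ∈ W := by
      intro s
      rw [hcolon, Submodule.mem_comap]
      have h1 := hz s
      rw [hz', bdry_add, bdry_add, bdry_bdry hcomm, zero_add, hbu] at h1
      exact (Submodule.add_mem_iff_left _ (bdry_mem hW hy s)).1 h1
    refine ⟨w + ∑ t, h t • extMul (K := K) t u, fun s => ?_⟩
    have hhom : mulForm x h k (u s) - bdry x (∑ t, h t • extMul (K := K) t u) s =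
        ∑ t, h t • extMul (K := K) t (bdry x u) s := by
      rw [bdry_sum_smul, mulForm_apply, ← Finset.sum_sub_distrib]
      refine Finset.sum_congr rfl fun t _ => ?_
      rw [← bdry_extMul_add, ← smul_sub, add_sub_cancel_left]
    have hmem : ∑ t, h t • extMul (K := K) t (bdry x u) s ∈ W := by
      refine Submodule.sum_mem _ fun t _ => Submodule.smul_mem _ _ ?_
      rw [extMul]
      split_ifs
      · exact Submodule.smul_mem _ _ (hdu _)
      · exact Submodule.zero_mem _
    rw [← hhom] at hmem
    rw [bdry_add, hzs s]
    convert Submodule.add_mem _ hmem (hy s) using 1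
    abel

end Koszul

section BaseChange

open TensorProduct

variable {ℓ : ℕ} {E : ℕ → Type} [∀ k, AddCommGroup (E k)] [∀ k, Module K (E k)]
  {x : Fin ℓ → ∀ k, E k →ₗ[K] E (k + 1)}

/-- The variables acting after extension of scalars to an algebraic closure. -/
noncomputable def baseChangeVar (x : Fin ℓ → ∀ k, E k →ₗ[K] E (k + 1)) (t : Fin ℓ) (k : ℕ) :
    (AlgebraicClosure K ⊗[K] E k) →ₗ[AlgebraicClosure K] (AlgebraicClosure K ⊗[K] E (k + 1)) :=
  (x t k).baseChange (AlgebraicClosure K)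

lemma baseChangeVar_comm
    (hcomm : ∀ s t k (e : E k), x s (k + 1) (x t k e) = x t (k + 1) (x s k e))
    (s t : Fin ℓ) (k : ℕ) (e : AlgebraicClosure K ⊗[K] E k) :
    baseChangeVar x s (k + 1) (baseChangeVar x t k e) =
      baseChangeVar x t (k + 1) (baseChangeVar x s k e) := by
  induction e using TensorProduct.induction_on with
  | zero => simp
  | tmul a e => simp [baseChangeVar, hcomm s t]
  | add e f he hf => rw [map_add, map_add, he, hf, map_add, map_add]

lemma baseChangeVar_gen
    (hgen : ∀ k (e : E (k + 1)), ∃ v : Fin ℓ → E k, e = ∑ t, x t k (v t))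
    (k : ℕ) (e : AlgebraicClosure K ⊗[K] E (k + 1)) :
    ∃ v : Fin ℓ → AlgebraicClosure K ⊗[K] E k, e = ∑ t, baseChangeVar x t k (v t) := by
  induction e using TensorProduct.induction_on with
  | zero => exact ⟨0, by simp⟩
  | tmul a e =>
    obtain ⟨v, rfl⟩ := hgen k e
    exact ⟨fun t => a ⊗ₜ v t, by simp [baseChangeVar, tmul_sum]⟩
  | add e f he hf =>
    obtain ⟨v, hv⟩ := he
    obtain ⟨w, hw⟩ := hf
    exact ⟨v + w, by simp [hv, hw, Finset.sum_add_distrib]⟩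

lemma finrank_baseChange_quotient_bot (k : ℕ) :
    Module.finrank (AlgebraicClosure K) ((AlgebraicClosure K ⊗[K] E k) ⧸
      (⊥ : Submodule (AlgebraicClosure K) (AlgebraicClosure K ⊗[K] E k))) =
      Module.finrank K (E k) := by
  rw [(Submodule.quotEquivOfEqBot _ rfl).finrank_eq, Module.finrank_baseChange]

variable [∀ k, FiniteDimensional K (E k)]

/-- Macaulay's bound over an arbitrary field. -/
theorem finrank_le_consRank
    (hcomm : ∀ s t k (e : E k), x s (k + 1) (x t k e) = x t (k + 1) (x s k e))
    (hgen : ∀ k (e : E (k + 1)), ∃ v : Fin ℓ → E k, e = ∑ t, x t k (v t)) (k : ℕ) :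
    Module.finrank K (E (k + 1 + 1)) ≤ consRank k (Module.finrank K (E (k + 1))) := by
  have := codim_le_consRank (x := baseChangeVar x) (baseChangeVar_comm hcomm)
    (baseChangeVar_gen hgen) k ⊥ ⊥ (by
      intro t e he
      rw [Submodule.mem_bot] at he ⊢
      rw [he, map_zero])
  rwa [finrank_baseChange_quotient_bot, finrank_baseChange_quotient_bot] at this

/-- Maximal growth forces exactness of the Koszul complex, over an arbitrary field. -/
theorem exists_eq_bdry
    (hcomm : ∀ s t k (e : E k), x s (k + 1) (x t k e) = x t (k + 1) (x s k e))
    (hgen : ∀ k (e : E (k + 1)), ∃ v : Fin ℓ → E k, e = ∑ t, x t k (v t)) (k : ℕ)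
    (hgrow : consRank k (Module.finrank K (E (k + 1))) ≤ Module.finrank K (E (k + 1 + 1)))
    (z : Finset (Fin ℓ) → E (k + 1)) (hz : ∀ s, bdry x z s = 0) :
    ∃ w : Finset (Fin ℓ) → E k, ∀ s, z s = bdry x w s := by
  have hsign : ∀ (t : Fin ℓ) (s : Finset (Fin ℓ)) {j : ℕ} (e : AlgebraicClosure K ⊗[K] E j),
      koszulSign (AlgebraicClosure K) t s • e = koszulSign K t s • e := by
    intro t s j e
    have : koszulSign (AlgebraicClosure K) t s = algebraMap K _ (koszulSign K t s) := by
      simp [koszulSign]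
    rw [this, algebraMap_smul]
  obtain ⟨w, hw⟩ := exists_sub_bdry_mem (x := baseChangeVar x) (baseChangeVar_comm hcomm)
    (baseChangeVar_gen hgen) k ⊥ ⊥ (by
      intro t e he
      rw [Submodule.mem_bot] at he ⊢
      rw [he, map_zero]) (by
      rwa [finrank_baseChange_quotient_bot, finrank_baseChange_quotient_bot])
    (fun s => 1 ⊗ₜ z s) (by
      intro s
      have : bdry (baseChangeVar x) (fun s => (1 : AlgebraicClosure K) ⊗ₜ[K] z s) s =
          1 ⊗ₜ bdry x z s := by
        simp only [bdry, hsign, tmul_sum, tmul_smul]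
        rfl
      rw [this, hz, tmul_zero]
      exact Submodule.zero_mem _)
  obtain ⟨ρ, hρ⟩ := LinearMap.exists_leftInverse_of_injective
    (Algebra.linearMap K (AlgebraicClosure K))
    (LinearMap.ker_eq_bot.2 (algebraMap K (AlgebraicClosure K)).injective)
  have hρ1 : ρ 1 = 1 := by simpa using LinearMap.congr_fun hρ 1
  let r : ∀ j, (AlgebraicClosure K ⊗[K] E j) →ₗ[K] E j := fun j =>
    (TensorProduct.lid K (E j)).toLinearMap ∘ₗ ρ.rTensor (E j)
  have hr : ∀ (t : Fin ℓ) (j : ℕ) (e : AlgebraicClosure K ⊗[K] E j),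
      r (j + 1) (baseChangeVar x t j e) = x t j (r j e) := by
    intro t j e
    induction e using TensorProduct.induction_on with
    | zero => simp
    | tmul a e => simp [r, baseChangeVar]
    | add e f he hf => simp only [map_add, he, hf]
  refine ⟨fun s => r k (w s), fun s => ?_⟩
  have h1 := hw s
  rw [Submodule.mem_bot, sub_eq_zero] at h1
  have h2 := congrArg (r (k + 1)) h1
  have h3 : r (k + 1) (1 ⊗ₜ z s) = z s := by simp [r, hρ1]
  rw [h3] at h2
  rw [h2]
  simp only [bdry, hsign, map_sum, map_smul, hr]

end BaseChange

section Betti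

variable {n : ℕ}

/-- The Koszul differential on chains of polynomials. -/
noncomputable def polyBdry (z : Finset (Fin n) → MvPolynomial (Fin n) K) (s : Finset (Fin n)) :
    MvPolynomial (Fin n) K :=
  ∑ t ∈ sᶜ, koszulSign K t s • (X t * z (insert t s))

lemma polyBdry_congr {z w : Finset (Fin n) → MvPolynomial (Fin n) K} {s : Finset (Fin n)}
    (h : ∀ t ∉ s, z (insert t s) = w (insert t s)) : polyBdry z s = polyBdry w s :=
  Finset.sum_congr rfl fun t ht => by rw [h t (by simpa using ht)]

/-- Extend a homogeneous Koszul chain by zero to all sets of variables. -/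
noncomputable def extendZero {I : Ideal (MvPolynomial (Fin n) K)} {i : ℕ} {k : ℤ}
    (z : KoszulIdx n i → idealPiece I k) (s : Finset (Fin n)) : MvPolynomial (Fin n) K :=
  if h : s.card = i then z ⟨s, h⟩ else 0

lemma extendZero_mem {I : Ideal (MvPolynomial (Fin n) K)} {i : ℕ} {k : ℤ}
    (z : KoszulIdx n i → idealPiece I k) (s : Finset (Fin n)) :
    extendZero z s ∈ idealPiece I k := by
  rw [extendZero]
  split_ifs
  · exact Subtype.prop _
  · exact Submodule.zero_mem _

lemma koszulDiff_apply_coe (I : Ideal (MvPolynomial (Fin n) K)) (i : ℕ) (j : ℤ)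
    (z : KoszulIdx n (i + 1) → idealPiece I (j - (i + 1 : ℕ))) (s : KoszulIdx n i) :
    ((koszulDiff I i j z s : idealPiece I (j - (i : ℕ))) : MvPolynomial (Fin n) K) =
      polyBdry (extendZero z) s.1 := by
  classical
  have h1 : ((koszulDiff I i j z s : idealPiece I (j - (i : ℕ))) : MvPolynomial (Fin n) K) =
      ∑ s' : KoszulIdx n (i + 1), ∑ t : Fin n, if t ∈ s'.1 ∧ s'.1.erase t = s.1 then
        koszulSign K t s'.1 • (X t * (z s' : MvPolynomial (Fin n) K)) else 0 := by
    rw [koszulDiff, LinearMap.sum_apply, Finset.sum_apply, AddSubmonoidClass.coe_finsetSum]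
    refine Finset.sum_congr rfl fun s' _ => ?_
    rw [LinearMap.sum_apply, Finset.sum_apply, AddSubmonoidClass.coe_finsetSum]
    have h2 : ∀ t : {t // t ∈ s'.1},
        (if t.1 ∈ s'.1 ∧ s'.1.erase t.1 = s.1 then
          koszulSign K t.1 s'.1 • (X t.1 * (z s' : MvPolynomial (Fin n) K)) else 0) =
        if s'.1.erase t.1 = s.1 then
          koszulSign K t.1 s'.1 • (X t.1 * (z s' : MvPolynomial (Fin n) K)) else 0 := by
      intro t
      simp [t.2]
    have h3 : ∑ t : Fin n, (if t ∈ s'.1 ∧ s'.1.erase t = s.1 then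
          koszulSign K t s'.1 • (X t * (z s' : MvPolynomial (Fin n) K)) else 0) =
        ∑ t ∈ s'.1.attach, (if s'.1.erase t.1 = s.1 then
          koszulSign K t.1 s'.1 • (X t.1 * (z s' : MvPolynomial (Fin n) K)) else 0) := by
      rw [← Finset.sum_congr rfl (fun t _ => h2 t),
        Finset.sum_attach s'.1 (fun t => if t ∈ s'.1 ∧ s'.1.erase t = s.1 then
          koszulSign K t s'.1 • (X t * (z s' : MvPolynomial (Fin n) K)) else 0)]
      symm
      refine Finset.sum_subset (Finset.subset_univ _) fun t _ ht => ?_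
      rw [if_neg fun h => ht h.1]
    rw [h3]
    refine Finset.sum_congr rfl fun t _ => ?_
    by_cases hs : s'.1.erase t.1 = s.1
    · obtain ⟨s, hs0⟩ := s
      dsimp only at hs
      subst hs
      rw [if_pos rfl]
      simp [koszulSign, mulXPiece]
      rfl
    · rw [if_neg hs]
      have : s ≠ ⟨s'.1.erase t.1, by rw [Finset.card_erase_of_mem t.2, s'.2]; rfl⟩ :=
        fun h => hs (congrArg Subtype.val h).symm
      simp [Pi.single_eq_of_ne this]
  rw [h1, Finset.sum_comm, polyBdry, ← Finset.sum_subset (Finset.subset_univ s.1ᶜ)]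
  · refine Finset.sum_congr rfl fun t ht => ?_
    have hts : t ∉ s.1 := by simpa using ht
    have hcard : (insert t s.1).card = i + 1 := by
      rw [Finset.card_insert_of_notMem hts, s.2]
    rw [Finset.sum_eq_single ⟨insert t s.1, hcard⟩]
    · rw [if_pos ⟨Finset.mem_insert_self _ _, Finset.erase_insert hts⟩, extendZero, dif_pos hcard,
        koszulSign_insert hts, if_neg (lt_irrefl t)]
    · intro s' _ hs'
      rw [if_neg]
      rintro ⟨h1, h2⟩
      refine hs' (Subtype.ext ?_)
      exact (Finset.insert_erase h1).symm.trans (congrArg (insert t) h2)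
    · intro h
      exact absurd (Finset.mem_univ _) h
  · intro t _ ht
    have hts : t ∈ s.1 := by simpa using ht
    refine Finset.sum_eq_zero fun s' _ => if_neg ?_
    rintro ⟨-, h2⟩
    rw [← h2] at hts
    exact Finset.notMem_erase _ _ hts

lemma idealPiece_le_homogeneousSubmodule (I : Ideal (MvPolynomial (Fin n) K)) (k : ℤ) :
    idealPiece I k ≤ homogeneousSubmodule (Fin n) K k.toNat := by
  rw [idealPiece]
  split_ifs
  · exact inf_le_right
  · exact bot_le

instance finiteDimensional_homogeneousSubmodule (k : ℕ) :
    FiniteDimensional K (homogeneousSubmodule (Fin n) K k) := by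
  have : homogeneousSubmodule (Fin n) K k ≤ restrictTotalDegree (Fin n) K k := by
    intro p hp
    rw [mem_restrictTotalDegree]
    exact ((mem_homogeneousSubmodule _ _).1 hp).totalDegree_le
  exact Submodule.finiteDimensional_of_le this

instance finiteDimensional_idealPiece (I : Ideal (MvPolynomial (Fin n) K)) (k : ℤ) :
    FiniteDimensional K (idealPiece I k) :=
  Submodule.finiteDimensional_of_le (idealPiece_le_homogeneousSubmodule I k)

lemma gradedBetti_eq_zero_of_le {I : Ideal (MvPolynomial (Fin n) K)} {i : ℕ} {j : ℤ}
    (h : koszulCycles I i j ≤ LinearMap.range (koszulDiff I i j)) : gradedBetti I i j = 0 := by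
  rw [gradedBetti, inf_eq_right.2 h, Nat.sub_self]

lemma koszulCycles_le_range_of_gradedBetti_eq_zero {I : Ideal (MvPolynomial (Fin n) K)} {i : ℕ}
    {j : ℤ} (h : gradedBetti I i j = 0) :
    koszulCycles I i j ≤ LinearMap.range (koszulDiff I i j) := by
  rw [gradedBetti, Nat.sub_eq_zero_iff_le] at h
  have := Submodule.eq_of_le_of_finrank_le inf_le_right h
  exact inf_eq_right.1 this

lemma gradedBetti_eq_zero_of_eq_bot {I : Ideal (MvPolynomial (Fin n) K)} {i : ℕ} {j : ℤ}
    (h : idealPiece I (j - (i : ℕ)) = ⊥) : gradedBetti I i j = 0 := by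
  refine gradedBetti_eq_zero_of_le fun z _ => ?_
  have : z = 0 := by
    funext s
    exact Subtype.ext ((Submodule.mem_bot K).1 (h.le (z s).2))
  rw [this]
  exact Submodule.zero_mem _

lemma polyBdry_extendZero_of_mem_koszulCycles {I : Ideal (MvPolynomial (Fin n) K)} {i : ℕ} {j : ℤ}
    {z : KoszulIdx n i → idealPiece I (j - (i : ℕ))} (hz : z ∈ koszulCycles I i j)
    (s : Finset (Fin n)) : polyBdry (extendZero z) s = 0 := by
  have hzero : ∀ r : Finset (Fin n), r.card + 1 ≠ i → polyBdry (extendZero z) r = 0 := by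
    intro r hr
    refine Finset.sum_eq_zero fun t ht => ?_
    rw [extendZero, dif_neg, mul_zero, smul_zero]
    rwa [Finset.card_insert_of_notMem (by simpa using ht)]
  rcases i with _ | i
  · exact hzero s (by omega)
  · by_cases hs : s.card = i
    · have hz' : koszulDiff I i j z = 0 := hz
      have := koszulDiff_apply_coe I i j z ⟨s, hs⟩
      rw [hz'] at this
      exact this.symm
    · exact hzero s (by omega)

/-- Exactness of the Koszul complex on polynomial chains forces a graded Betti number to
vanish. -/
lemma gradedBetti_eq_zero_of_exact {I : Ideal (MvPolynomial (Fin n) K)} {i : ℕ} {j : ℤ}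
    (h : ∀ z : Finset (Fin n) → MvPolynomial (Fin n) K,
      (∀ s, z s ∈ idealPiece I (j - (i : ℕ))) → (∀ s, s.card ≠ i → z s = 0) →
      (∀ s, polyBdry z s = 0) →
      ∃ w : Finset (Fin n) → MvPolynomial (Fin n) K,
        (∀ s, w s ∈ idealPiece I (j - (i + 1 : ℕ))) ∧ ∀ s, z s = polyBdry w s) :
    gradedBetti I i j = 0 := by
  refine gradedBetti_eq_zero_of_le fun z hz => ?_
  obtain ⟨w, hw, hzw⟩ := h (extendZero z) (extendZero_mem z)
    (fun s hs => by rw [extendZero, dif_neg hs])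
    (polyBdry_extendZero_of_mem_koszulCycles hz)
  refine ⟨fun s => ⟨w s.1, hw s.1⟩, ?_⟩
  funext s
  refine Subtype.ext ?_
  rw [koszulDiff_apply_coe]
  have h1 := hzw s.1
  rw [extendZero, dif_pos s.2] at h1
  rw [h1]
  refine polyBdry_congr fun t ht => ?_
  rw [extendZero, dif_pos (by rw [Finset.card_insert_of_notMem ht, s.2])]

lemma exists_eq_sum_of_gradedBetti_eq_zero {I : Ideal (MvPolynomial (Fin n) K)} {k : ℕ}
    (h : gradedBetti I 0 (k + 1 : ℤ) = 0) {p : MvPolynomial (Fin n) K}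
    (hp : p ∈ idealPiece I (k + 1 : ℤ)) :
    ∃ v : Fin n → MvPolynomial (Fin n) K, (∀ t, v t ∈ idealPiece I (k : ℤ)) ∧
      p = ∑ t, X t * v t := by
  have hp' : p ∈ idealPiece I ((k + 1 : ℤ) - (0 : ℕ)) := by
    rwa [Nat.cast_zero, sub_zero]
  obtain ⟨w, hw⟩ := koszulCycles_le_range_of_gradedBetti_eq_zero h
    (show (fun _ => ⟨p, hp'⟩) ∈ koszulCycles I 0 (k + 1 : ℤ) from Submodule.mem_top)
  have h1 := congrArg Subtype.val (congrFun hw ⟨∅, rfl⟩)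
  rw [koszulDiff_apply_coe] at h1
  refine ⟨fun t => koszulSign K t ∅ • extendZero w {t}, fun t => Submodule.smul_mem _ _ ?_, ?_⟩
  · have he : idealPiece I ((k + 1 : ℤ) - (0 + 1 : ℕ)) = idealPiece I k := by
      congr 1
      push_cast
      ring
    exact he.le (extendZero_mem w {t})
  · refine h1.symm.trans ?_
    simp [polyBdry]

end Betti

section Monomials

open DegMon

/-- Exponent vectors of degree `k` in `n` variables. -/
abbrev Mon (n k : ℕ) := {v : Fin n →₀ ℕ // v.degree = k}

instance finite_mon (n k : ℕ) : Finite (Mon n k) := by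
  have : Set.InjOn (fun (w : Fin n →₀ ℕ) (i : Fin n) => (Fin.ofNat (k + 1) (w i)))
      {w : Fin n →₀ ℕ | w.degree = k} := by
    intro v hv w hw h
    ext i
    have h1 := congrArg Fin.val (congrFun h i)
    have h2 : v i ≤ k := (Finsupp.le_degree i v).trans (le_of_eq hv)
    have h3 : w i ≤ k := (Finsupp.le_degree i w).trans (le_of_eq hw)
    simp only [Fin.val_ofNat] at h1
    rwa [Nat.mod_eq_of_lt (by omega), Nat.mod_eq_of_lt (by omega)] at h1
  exact Set.Finite.of_finite_image (Set.toFinite _) this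

/-- The number of monomials of degree `k` in `n` variables. -/
noncomputable def numMon (n k : ℕ) : ℕ := Nat.card (Mon n k)

lemma finrank_restrictSupport {σ : Type} (A : Set (σ →₀ ℕ)) :
    Module.finrank K (restrictSupport K A) = Nat.card A :=
  Module.finrank_eq_nat_card_basis (basisRestrictSupport K A)

lemma homogeneousSubmodule_eq_restrictSupport (n k : ℕ) :
    homogeneousSubmodule (Fin n) K k = restrictSupport K {v | v.degree = k} :=
  homogeneousSubmodule_eq_finsupp_supported (Fin n) K k

lemma finrank_homogeneousSubmodule (n k : ℕ) :
    Module.finrank K (homogeneousSubmodule (Fin n) K k) = numMon n k := by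
  rw [homogeneousSubmodule_eq_restrictSupport, finrank_restrictSupport]
  rfl

variable {n k : ℕ}

namespace DegMon

/-- View a monomial in finitely many variables as a monomial in countably many variables. -/
noncomputable def ofMon (v : Mon n k) : DegMon k :=
  ⟨toColex (v.1.mapDomain Fin.val), (Finsupp.degree_mapDomain _ _).trans v.2⟩

lemma ofMon_exp (v : Mon n k) (i : Fin n) : (ofMon v).exp i = v.1 i :=
  Finsupp.mapDomain_apply Fin.val_injective _ _

lemma ofMon_exp_of_le (v : Mon n k) {i : ℕ} (h : n ≤ i) : (ofMon v).exp i = 0 :=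
  Finsupp.mapDomain_of_notMem_range _ _ (by rintro ⟨j, rfl⟩; omega)

lemma ofMon_injective : Function.Injective (ofMon (n := n) (k := k)) := by
  intro v w h
  refine Subtype.ext (Finsupp.ext fun i => ?_)
  rw [← ofMon_exp, ← ofMon_exp, h]

lemma mem_range_ofMon {w : DegMon k} :
    w ∈ Set.range (ofMon (n := n)) ↔ ∀ j, n ≤ j → w.exp j = 0 := by
  constructor
  · rintro ⟨v, rfl⟩ j hj
    exact ofMon_exp_of_le v hj
  · intro h
    have hmap : ((ofColex w.1).comapDomain (Fin.val : Fin n → ℕ)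
        Fin.val_injective.injOn).mapDomain Fin.val = ofColex w.1 := by
      apply Finsupp.mapDomain_comapDomain _ Fin.val_injective
      intro i hi
      rcases lt_or_ge i n with hin | hin
      · exact ⟨⟨i, hin⟩, rfl⟩
      · exact absurd (h i hin) (by simpa [exp] using hi)
    have hdeg : ((ofColex w.1).comapDomain (Fin.val : Fin n → ℕ)
        Fin.val_injective.injOn).degree = k := by
      have := w.2
      rw [← hmap, Finsupp.degree_mapDomain] at this
      exact this
    let v : Mon n k := ⟨_, hdeg⟩
    have hv : (ofMon v).1 = w.1 := congrArg toColex hmap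
    exact ⟨v, Subtype.ext hv⟩

lemma ofMon_lt_iff {v w : Mon n k} : ofMon v < ofMon w ↔ LexLT v.1 w.1 := by
  rw [lt_iff, LexLT]
  constructor
  · rintro ⟨i, h1, h2⟩
    rcases lt_or_ge i n with hin | hin
    · have e1 := ofMon_exp v ⟨i, hin⟩
      have e2 := ofMon_exp w ⟨i, hin⟩
      refine ⟨⟨i, hin⟩, by dsimp only at e1 e2; omega, fun j hj => ?_⟩
      rw [← ofMon_exp v, ← ofMon_exp w, h1 j hj]
    · rw [ofMon_exp_of_le w hin] at h2
      omega
  · rintro ⟨i, h1, h2⟩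
    refine ⟨i, fun j hj => ?_, by rwa [ofMon_exp, ofMon_exp]⟩
    rcases lt_or_ge j n with hjn | hjn
    · have := h2 ⟨j, hjn⟩ hj
      rwa [← ofMon_exp v, ← ofMon_exp w] at this
    · rw [ofMon_exp_of_le v hjn, ofMon_exp_of_le w hjn]

end DegMon

/-- The position of a monomial of degree `k + 1` among all monomials of that degree. -/
noncomputable def monRank (v : Mon n (k + 1)) : ℕ := rank (ofMon v)

lemma monRank_injective : Function.Injective (monRank (n := n) (k := k)) :=
  rank.injective.comp ofMon_injective

lemma monRank_lt_iff {v w : Mon n (k + 1)} : monRank v < monRank w ↔ LexLT v.1 w.1 := by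
  rw [monRank, monRank, rank.lt_iff_lt, ofMon_lt_iff]

lemma mem_iff_lt_ncard {R : Set ℕ} (hR : R.Finite) (hlow : ∀ q ∈ R, ∀ p ≤ q, p ∈ R) (q : ℕ) :
    q ∈ R ↔ q < R.ncard := by
  classical
  obtain ⟨N, hN⟩ := hR.exists_notMem
  have hex : ∃ N, N ∉ R := ⟨N, hN⟩
  obtain ⟨M, rfl⟩ : ∃ M, R = Set.Iio M := by
    refine ⟨Nat.find hex, Set.ext fun p => ?_⟩
    rw [Set.mem_Iio]
    constructor
    · intro hp
      by_contra hle
      exact Nat.find_spec hex (hlow p hp _ (not_lt.1 hle))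
    · intro hp
      exact not_not.1 (Nat.find_min hex hp)
  rw [← Nat.card_coe_set_eq, Nat.card_eq_fintype_card, Fintype.card_Iio, Nat.card_Iio,
    Set.mem_Iio]

lemma mem_range_monRank {q : ℕ} :
    q ∈ Set.range (monRank (n := n) (k := k)) ↔ q < numMon n (k + 1) := by
  rw [mem_iff_lt_ncard (Set.finite_range _)]
  · rw [← Nat.card_coe_set_eq, Nat.card_range_of_injective monRank_injective, numMon]
  · rintro _ ⟨v, rfl⟩ p hp
    rw [monRank, ← OrderIso.symm_apply_le] at hp
    obtain ⟨w, hw⟩ := mem_range_ofMon.2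
      (exp_eq_zero_of_le hp (fun j hj => ofMon_exp_of_le v hj))
    exact ⟨w, by rw [monRank, hw, OrderIso.apply_symm_apply]⟩

lemma monRank_lt (v : Mon n (k + 1)) : monRank v < numMon n (k + 1) :=
  mem_range_monRank.1 ⟨v, rfl⟩

lemma ncard_monRank_lt {c : ℕ} (hc : c ≤ numMon n (k + 1)) :
    {v : Mon n (k + 1) | monRank v < c}.ncard = c := by
  rw [← Set.ncard_image_of_injective _ monRank_injective]
  have : monRank '' {v : Mon n (k + 1) | monRank v < c} = Set.Iio c := by
    ext q
    constructor
    · rintro ⟨v, hv, rfl⟩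
      exact hv
    · intro hq
      obtain ⟨v, rfl⟩ := mem_range_monRank.2 (lt_of_lt_of_le hq hc)
      exact ⟨v, hq, rfl⟩
  rw [this, ← Nat.card_coe_set_eq, Nat.card_eq_fintype_card, Fintype.card_Iio, Nat.card_Iio]

lemma ncard_monRank_le_add {c : ℕ} (hc : c ≤ numMon n (k + 1)) :
    {v : Mon n (k + 1) | c ≤ monRank v}.ncard + c = numMon n (k + 1) := by
  have := Set.ncard_add_ncard_compl {v : Mon n (k + 1) | c ≤ monRank v}
  rw [show {v : Mon n (k + 1) | c ≤ monRank v}ᶜ = {v : Mon n (k + 1) | monRank v < c} by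
    ext v; simp, ncard_monRank_lt hc] at this
  exact this

/-- The monomials at least `v` form a final segment of the monomials of the degree of `v`. -/
lemma ncard_ge_add_monRank (v : Mon n (k + 1)) :
    {w : Fin n →₀ ℕ | (∑ i, w i) = (∑ i, v.1 i) ∧ (v.1 = w ∨ LexLT v.1 w)}.ncard + monRank v =
      numMon n (k + 1) := by
  rw [← ncard_monRank_le_add (monRank_lt v).le,
    ← Set.ncard_image_of_injective _ Subtype.val_injective]
  congr 2
  ext w
  have hv : ∑ i, v.1 i = k + 1 := by rw [← Finsupp.degree_eq_sum, v.2]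
  rw [Set.mem_ofPred_eq, hv, ← Finsupp.degree_eq_sum]
  constructor
  · rintro ⟨h1, h2⟩
    refine ⟨⟨w, h1⟩, ?_, rfl⟩
    rcases h2 with h2 | h2
    · exact le_of_eq (congrArg monRank (Subtype.ext h2))
    · exact (monRank_lt_iff.2 h2).le
  · rintro ⟨w, hw, rfl⟩
    refine ⟨w.2, ?_⟩
    rcases (show monRank v ≤ monRank w from hw).eq_or_lt with h | h
    · exact Or.inl (congrArg Subtype.val (monRank_injective h))
    · exact Or.inr (monRank_lt_iff.1 h)

/-- Divide a monomial by a variable. -/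
noncomputable def divMon (v : Mon n (k + 1)) (t : Fin n) (h : v.1 t ≠ 0) : Mon n k :=
  ⟨v.1 - Finsupp.single t 1, by
    have hle : Finsupp.single t 1 ≤ v.1 := by
      rw [Finsupp.single_le_iff]
      exact Nat.one_le_iff_ne_zero.2 h
    have hadd := tsub_add_cancel_of_le hle
    have := v.2
    rw [← hadd, map_add] at this
    simpa using this⟩

lemma ofMon_divMon (v : Mon n (k + 1)) (t : Fin n) (h : v.1 t ≠ 0) :
    ofMon (divMon v t h) = (ofMon v).div t (by rwa [ofMon_exp]) := by
  refine ext_exp fun i => ?_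
  rw [div_exp]
  rcases lt_or_ge i n with hi | hi
  · have e1 := ofMon_exp v ⟨i, hi⟩
    have e2 := ofMon_exp (divMon v t h) ⟨i, hi⟩
    dsimp only at e1 e2
    rw [e1, e2]
    simp [divMon, Finsupp.single_apply, Fin.ext_iff]
  · rw [ofMon_exp_of_le _ hi, ofMon_exp_of_le _ hi, Nat.zero_sub]

lemma monRank_lt_consRank_iff (v : Mon n (k + 2)) (c : ℕ) :
    monRank v < consRank k c ↔ ∀ t h, monRank (divMon v t h) < c := by
  rw [monRank, rank_lt_consRank_iff]
  constructor
  · intro h t ht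
    rw [monRank, ofMon_divMon]
    exact h _ _
  · intro h t ht
    have htn : t < n := by
      by_contra hle
      exact ht (ofMon_exp_of_le v (not_lt.1 hle))
    have ht' : v.1 ⟨t, htn⟩ ≠ 0 := by
      rwa [← ofMon_exp]
    have := h ⟨t, htn⟩ ht'
    rwa [monRank, ofMon_divMon] at this

lemma consRank_numMon_le (n k : ℕ) : consRank k (numMon n (k + 1)) ≤ numMon n (k + 2) := by
  by_contra hlt
  rw [not_le] at hlt
  obtain ⟨u, hu⟩ : ∃ u : DegMon (k + 2), rank u = numMon n (k + 2) := 
    ⟨rank.symm (numMon n (k + 2)), OrderIso.apply_symm_apply _ _⟩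
  rw [← hu, rank_lt_consRank_iff] at hlt
  have hmem : u ∈ Set.range (ofMon (n := n)) := by
    rw [mem_range_ofMon]
    intro j hj
    by_contra hne
    have hdiv : ∀ t h, ∀ i, n ≤ i → (u.div t h).exp i = 0 := by
      intro t h
      obtain ⟨w, hw⟩ := mem_range_monRank.2 (hlt t h)
      rw [← rank.injective hw]
      exact fun i hi => ofMon_exp_of_le w hi
    obtain ⟨i, h2⟩ : ∃ i, (u.div j hne).exp i ≠ 0 := ⟨_, exp_minVar_ne_zero _⟩
    have hij : j ≠ i := by
      intro hij
      rw [← hij] at h2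
      exact h2 (hdiv j hne j hj)
    rw [div_exp] at h2
    rw [if_neg hij, Nat.sub_zero] at h2
    have h3 := hdiv i h2 j hj
    rw [div_exp, if_neg (Ne.symm hij), Nat.sub_zero] at h3
    exact hne h3
  obtain ⟨v, rfl⟩ := hmem
  exact absurd hu (monRank_lt v).ne

end Monomials

section Families

variable {n : ℕ}

/-- Multiplication by a variable on homogeneous polynomials. -/
noncomputable def mulXHom (t : Fin n) (k : ℕ) :
    homogeneousSubmodule (Fin n) K k →ₗ[K] homogeneousSubmodule (Fin n) K (k + 1) :=
  (LinearMap.mulLeft K (X t)).restrict fun p hp => by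
    rw [mem_homogeneousSubmodule] at hp ⊢
    rw [add_comm]
    exact (isHomogeneous_X K t).mul hp

lemma exists_eq_sum_mulXHom (k : ℕ) (p : homogeneousSubmodule (Fin n) K (k + 1)) :
    ∃ v : Fin n → homogeneousSubmodule (Fin n) K k, p = ∑ t, mulXHom t k (v t) := by
  let Φ : (Fin n → homogeneousSubmodule (Fin n) K k) →ₗ[K] MvPolynomial (Fin n) K :=
    (Submodule.subtype _) ∘ₗ ∑ t, mulXHom t k ∘ₗ LinearMap.proj t
  have hΦ : homogeneousSubmodule (Fin n) K (k + 1) ≤ LinearMap.range Φ := by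
    intro q hq
    rw [q.as_sum]
    refine Submodule.sum_mem _ fun v hv => ?_
    have hdeg : v.degree = k + 1 := by
      rw [mem_homogeneousSubmodule] at hq
      have := hq (mem_support_iff.1 hv)
      rw [Finsupp.degree_eq_weight_one]
      exact this
    obtain ⟨t, ht⟩ : ∃ t, v t ≠ 0 := by
      by_contra! h
      rw [show v = 0 from Finsupp.ext h, map_zero] at hdeg
      omega
    have hadd : v = Finsupp.single t 1 + (divMon ⟨v, hdeg⟩ t ht).1 := by
      rw [add_comm]
      exact (tsub_add_cancel_of_le (by
        rw [Finsupp.single_le_iff]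
        exact Nat.one_le_iff_ne_zero.2 ht)).symm
    have hmem : monomial (divMon ⟨v, hdeg⟩ t ht).1 (coeff v q) ∈
        homogeneousSubmodule (Fin n) K k :=
      isHomogeneous_monomial _ (divMon ⟨v, hdeg⟩ t ht).2
    refine ⟨Pi.single t ⟨_, hmem⟩, ?_⟩
    have : Φ (Pi.single t ⟨_, hmem⟩) = X t * monomial (divMon ⟨v, hdeg⟩ t ht).1 (coeff v q) := by
      simp only [Φ, LinearMap.comp_apply, LinearMap.sum_apply, LinearMap.proj_apply]
      rw [Finset.sum_eq_single t]
      · rw [Pi.single_eq_same]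
        rfl
      · intro u _ hu
        rw [Pi.single_eq_of_ne hu, map_zero]
      · intro h
        exact absurd (Finset.mem_univ _) h
    rw [this, X, monomial_mul, one_mul, ← hadd]
  obtain ⟨v, hv⟩ := hΦ p.2
  refine ⟨v, Subtype.ext (hv.symm.trans ?_)⟩
  simp [Φ]

/-- A family of spaces of homogeneous polynomials closed under multiplication by variables. -/
structure IsPieceFamily (W : ℕ → Submodule K (MvPolynomial (Fin n) K)) : Prop where
  le_homogeneous : ∀ k, W k ≤ homogeneousSubmodule (Fin n) K k
  X_mul_mem : ∀ k t q, q ∈ W k → X t * q ∈ W (k + 1)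

/-- The quotient of the homogeneous polynomials of degree `k` by a subspace. -/
def PieceQuot (W : ℕ → Submodule K (MvPolynomial (Fin n) K)) (k : ℕ) : Type :=
  homogeneousSubmodule (Fin n) K k ⧸ (W k).submoduleOf (homogeneousSubmodule (Fin n) K k)

noncomputable instance (W : ℕ → Submodule K (MvPolynomial (Fin n) K)) (k : ℕ) :
    AddCommGroup (PieceQuot W k) :=
  inferInstanceAs (AddCommGroup (homogeneousSubmodule (Fin n) K k ⧸
    (W k).submoduleOf (homogeneousSubmodule (Fin n) K k)))

noncomputable instance (W : ℕ → Submodule K (MvPolynomial (Fin n) K)) (k : ℕ) :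
    Module K (PieceQuot W k) :=
  inferInstanceAs (Module K (homogeneousSubmodule (Fin n) K k ⧸
    (W k).submoduleOf (homogeneousSubmodule (Fin n) K k)))

instance (W : ℕ → Submodule K (MvPolynomial (Fin n) K)) (k : ℕ) :
    FiniteDimensional K (PieceQuot W k) :=
  inferInstanceAs (FiniteDimensional K (homogeneousSubmodule (Fin n) K k ⧸
    (W k).submoduleOf (homogeneousSubmodule (Fin n) K k)))

/-- The quotient map of a family of pieces. -/
noncomputable def pieceMk (W : ℕ → Submodule K (MvPolynomial (Fin n) K)) (k : ℕ) :
    homogeneousSubmodule (Fin n) K k →ₗ[K] PieceQuot W k :=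
  Submodule.mkQ _

lemma pieceMk_surjective (W : ℕ → Submodule K (MvPolynomial (Fin n) K)) (k : ℕ) :
    Function.Surjective (pieceMk W k) :=
  Submodule.mkQ_surjective _

lemma pieceMk_eq_iff {W : ℕ → Submodule K (MvPolynomial (Fin n) K)} {k : ℕ}
    {p q : homogeneousSubmodule (Fin n) K k} :
    pieceMk W k p = pieceMk W k q ↔ (p : MvPolynomial (Fin n) K) - q ∈ W k :=
  Submodule.Quotient.eq _

variable {W : ℕ → Submodule K (MvPolynomial (Fin n) K)}

/-- Multiplication by a variable on the quotients of a family of pieces. -/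
noncomputable def mulXQuot (hW : IsPieceFamily W) (t : Fin n) (k : ℕ) :
    PieceQuot W k →ₗ[K] PieceQuot W (k + 1) :=
  Submodule.mapQ ((W k).submoduleOf _) ((W (k + 1)).submoduleOf _) (mulXHom t k) fun p hp => hW.X_mul_mem k t p.1 hp

lemma finrank_pieceQuot (hW : IsPieceFamily W) (k : ℕ) :
    Module.finrank K (PieceQuot W k) = numMon n k - Module.finrank K (W k) := by
  have h := ((W k).submoduleOf (homogeneousSubmodule (Fin n) K k)).finrank_quotient_add_finrank
  rw [finrank_homogeneousSubmodule,
    (Submodule.submoduleOfEquivOfLe (hW.le_homogeneous k)).finrank_eq] at h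
  change Module.finrank K (PieceQuot W k) + _ = _ at h
  omega

lemma mulXQuot_comm (hW : IsPieceFamily W) (s t : Fin n) (k : ℕ) (e : PieceQuot W k) :
    mulXQuot hW s (k + 1) (mulXQuot hW t k e) = mulXQuot hW t (k + 1) (mulXQuot hW s k e) := by
  obtain ⟨p, rfl⟩ := pieceMk_surjective _ _ e
  refine congrArg (pieceMk _ _) (Subtype.ext ?_)
  exact mul_left_comm _ _ _

lemma mulXQuot_gen (hW : IsPieceFamily W) (k : ℕ) (e : PieceQuot W (k + 1)) :
    ∃ v : Fin n → PieceQuot W k, e = ∑ t, mulXQuot hW t k (v t) := by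
  obtain ⟨p, rfl⟩ := pieceMk_surjective _ _ e
  obtain ⟨v, rfl⟩ := exists_eq_sum_mulXHom k p
  exact ⟨fun t => pieceMk _ _ (v t), map_sum _ _ _⟩

/-- Macaulay's bound for a family of pieces. -/
theorem IsPieceFamily.codim_le (hW : IsPieceFamily W) (k : ℕ) :
    numMon n (k + 2) - Module.finrank K (W (k + 2)) ≤
      consRank k (numMon n (k + 1) - Module.finrank K (W (k + 1))) := by
  have := finrank_le_consRank (E := PieceQuot W) (x := mulXQuot hW) (mulXQuot_comm hW) (mulXQuot_gen hW) k
  rwa [finrank_pieceQuot hW, finrank_pieceQuot hW] at this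

lemma bdry_mulXHom_coe (k : ℕ) (y : Finset (Fin n) → homogeneousSubmodule (Fin n) K k)
    (s : Finset (Fin n)) :
    (bdry (E := fun k => homogeneousSubmodule (Fin n) K k) mulXHom y s : MvPolynomial (Fin n) K) =
      polyBdry (fun s => (y s : MvPolynomial (Fin n) K)) s := by
  rw [bdry, polyBdry, AddSubmonoidClass.coe_finsetSum]
  rfl

lemma bdry_mulXQuot_mkQ (hW : IsPieceFamily W) (k : ℕ)
    (y : Finset (Fin n) → homogeneousSubmodule (Fin n) K k) (s : Finset (Fin n)) :
    bdry (E := PieceQuot W) (mulXQuot hW) (fun s => pieceMk W _ (y s)) s =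
      pieceMk W _ (bdry (E := fun k => homogeneousSubmodule (Fin n) K k) mulXHom y s) := by
  rw [bdry, bdry, map_sum]
  rfl

/-- If the codimension grows as fast as possible then cycles modulo the family are boundaries
modulo the family. -/
lemma IsPieceFamily.exists_sub_polyBdry_mem (hW : IsPieceFamily W) (k : ℕ)
    (hgrow : consRank k (numMon n (k + 1) - Module.finrank K (W (k + 1))) ≤
      numMon n (k + 2) - Module.finrank K (W (k + 2)))
    {z : Finset (Fin n) → MvPolynomial (Fin n) K}
    (hz : ∀ s, z s ∈ homogeneousSubmodule (Fin n) K (k + 1))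
    (hbz : ∀ s, polyBdry z s ∈ W (k + 2)) :
    ∃ w : Finset (Fin n) → MvPolynomial (Fin n) K,
      (∀ s, w s ∈ homogeneousSubmodule (Fin n) K k) ∧ ∀ s, z s - polyBdry w s ∈ W (k + 1) := by
  have hgrow' : consRank k (Module.finrank K (PieceQuot W (k + 1))) ≤
      Module.finrank K (PieceQuot W (k + 1 + 1)) := by
    rw [finrank_pieceQuot hW, finrank_pieceQuot hW]
    exact hgrow
  let y : Finset (Fin n) → homogeneousSubmodule (Fin n) K (k + 1) := fun s => ⟨z s, hz s⟩
  have hy : ∀ s, bdry (E := PieceQuot W) (mulXQuot hW) (fun s => pieceMk W _ (y s)) s = 0 := by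
    intro s
    rw [bdry_mulXQuot_mkQ hW (k + 1) y, ← map_zero (pieceMk W _), pieceMk_eq_iff,
      bdry_mulXHom_coe, ZeroMemClass.coe_zero, sub_zero]
    exact hbz s
  obtain ⟨w, hw⟩ := exists_eq_bdry (E := PieceQuot W) (x := mulXQuot hW) (mulXQuot_comm hW)
    (mulXQuot_gen hW) k hgrow' (fun s => pieceMk W _ (y s)) hy
  choose v hv using fun s => pieceMk_surjective _ _ (w s)
  refine ⟨fun s => v s, fun s => (v s).2, fun s => ?_⟩
  have h1 := hw s
  rw [← funext hv, bdry_mulXQuot_mkQ hW, pieceMk_eq_iff, bdry_mulXHom_coe] at h1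
  exact h1

lemma isPieceFamily_bot : IsPieceFamily (fun _ => (⊥ : Submodule K (MvPolynomial (Fin n) K))) :=
  ⟨fun _ => bot_le, fun k t q hq => by
    rw [Submodule.mem_bot] at hq ⊢
    rw [hq, mul_zero]⟩

lemma exists_eq_polyBdry_of_homogeneous (k : ℕ) {z : Finset (Fin n) → MvPolynomial (Fin n) K}
    (hz : ∀ s, z s ∈ homogeneousSubmodule (Fin n) K (k + 1)) (hbz : ∀ s, polyBdry z s = 0) :
    ∃ w : Finset (Fin n) → MvPolynomial (Fin n) K,
      (∀ s, w s ∈ homogeneousSubmodule (Fin n) K k) ∧ ∀ s, z s = polyBdry w s := by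
  obtain ⟨w, hw, h⟩ := (isPieceFamily_bot (K := K) (n := n)).exists_sub_polyBdry_mem k
    (by rw [finrank_bot, Nat.sub_zero, Nat.sub_zero]; exact consRank_numMon_le n k) hz
    (fun s => (Submodule.mem_bot K).2 (hbz s))
  exact ⟨w, hw, fun s => sub_eq_zero.1 ((Submodule.mem_bot K).1 (h s))⟩

/-- If the codimension grows as fast as possible then cycles in the next degree of the family
are boundaries. -/
theorem IsPieceFamily.exists_eq_polyBdry (hW : IsPieceFamily W) (k : ℕ)
    (hgrow : consRank k (numMon n (k + 1) - Module.finrank K (W (k + 1))) ≤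
      numMon n (k + 2) - Module.finrank K (W (k + 2)))
    {z : Finset (Fin n) → MvPolynomial (Fin n) K}
    (hz : ∀ s, z s ∈ W (k + 2)) (hbz : ∀ s, polyBdry z s = 0) :
    ∃ w : Finset (Fin n) → MvPolynomial (Fin n) K,
      (∀ s, w s ∈ W (k + 1)) ∧ ∀ s, z s = polyBdry w s := by
  obtain ⟨w, hw, hzw⟩ := exists_eq_polyBdry_of_homogeneous (k + 1)
    (fun s => hW.le_homogeneous _ (hz s)) hbz
  obtain ⟨v, -, hwv⟩ := hW.exists_sub_polyBdry_mem k hgrow hw (fun s => hzw s ▸ hz s)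
  refine ⟨fun s => w s - polyBdry v s, hwv, fun s => ?_⟩
  have hvv : polyBdry (polyBdry v) s = 0 :=
    bdry_bdry (E := fun _ => MvPolynomial (Fin n) K) (x := fun t _ => LinearMap.mulLeft K (X t))
      (fun s t _ e => mul_left_comm _ _ _) (k := 0) v s
  have hsub : polyBdry (fun s => w s - polyBdry v s) s =
      polyBdry w s - polyBdry (polyBdry v) s := by
    simp only [polyBdry, mul_sub, smul_sub, Finset.sum_sub_distrib]
  rw [hsub, hvv, sub_zero, hzw]

end Families

section Lex

variable {n : ℕ} {J : Ideal (MvPolynomial (Fin n) K)}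

lemma mem_idealPiece_natCast {I : Ideal (MvPolynomial (Fin n) K)} {k : ℕ}
    {p : MvPolynomial (Fin n) K} : p ∈ idealPiece I (k : ℤ) ↔ p ∈ I ∧ p.IsHomogeneous k := by
  rw [idealPiece, if_pos (Int.natCast_nonneg k)]
  rfl

lemma idealPiece_eq_bot_of_neg (I : Ideal (MvPolynomial (Fin n) K)) {k : ℤ} (hk : k < 0) :
    idealPiece I k = ⊥ := by
  rw [idealPiece, if_neg (not_le.2 hk)]

lemma idealPiece_zero_eq_bot (hJ : J ≠ ⊤) : idealPiece J (0 : ℕ) = ⊥ := by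
  rw [eq_bot_iff]
  intro p hp
  rw [mem_idealPiece_natCast, ← totalDegree_zero_iff_isHomogeneous] at hp
  rw [Submodule.mem_bot]
  obtain ⟨hpJ, hp0⟩ := hp
  rw [totalDegree_eq_zero_iff_eq_C] at hp0
  by_contra hne
  refine hJ (J.eq_top_of_isUnit_mem hpJ ?_)
  rw [hp0] at hne ⊢
  refine IsUnit.map C (isUnit_iff_ne_zero.2 fun h => hne ?_)
  rw [h, C_0]

lemma isPieceFamily_idealPiece (I : Ideal (MvPolynomial (Fin n) K)) :
    IsPieceFamily (fun k : ℕ => idealPiece I (k : ℤ)) :=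
  ⟨fun k => idealPiece_le_homogeneousSubmodule I k, fun k t _ hq => mul_X_mem_idealPiece I t k hq⟩

lemma finrank_idealPiece_le (I : Ideal (MvPolynomial (Fin n) K)) (k : ℕ) :
    Module.finrank K (idealPiece I (k : ℤ)) ≤ numMon n k := by
  rw [← finrank_homogeneousSubmodule (K := K)]
  exact Submodule.finrank_mono (idealPiece_le_homogeneousSubmodule I k)

/-- The codimension of the degree `k` piece of an ideal. -/
noncomputable def codimPiece (I : Ideal (MvPolynomial (Fin n) K)) (k : ℕ) : ℕ :=
  numMon n k - Module.finrank K (idealPiece I (k : ℤ))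

lemma codimPiece_le (I : Ideal (MvPolynomial (Fin n) K)) (k : ℕ) :
    codimPiece I k ≤ numMon n k :=
  Nat.sub_le _ _

/-- The exponents of the monomials generating the lexicographic ideal. -/
def lexSet (J : Ideal (MvPolynomial (Fin n) K)) : Set (Fin n →₀ ℕ) :=
  {v | Set.ncard {w : Fin n →₀ ℕ | (∑ i, w i) = (∑ i, v i) ∧ (v = w ∨ LexLT v w)} ≤
    Module.finrank K ↥(idealPiece J ((∑ i, v i : ℕ) : ℤ))}

lemma lexIdeal_eq_span (J : Ideal (MvPolynomial (Fin n) K)) :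
    LexIdeal J = Ideal.span ((fun v => monomial v (1 : K)) '' lexSet J) := by
  rw [LexIdeal]
  congr 1
  ext p
  exact exists_congr fun v => and_congr_right fun _ => eq_comm

lemma mem_lexSet_iff {k : ℕ} (v : Mon n (k + 1)) :
    v.1 ∈ lexSet J ↔ codimPiece J (k + 1) ≤ monRank v := by
  have h1 := ncard_ge_add_monRank v
  have h2 := finrank_idealPiece_le J (k + 1)
  have hv : ∑ i, v.1 i = k + 1 := by rw [← Finsupp.degree_eq_sum, v.2]
  rw [lexSet, Set.mem_ofPred_eq, codimPiece]
  rw [hv] at h1 ⊢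
  omega

lemma zero_notMem_lexSet (hJ : J ≠ ⊤) : (0 : Fin n →₀ ℕ) ∉ lexSet J := by
  have hset : {w : Fin n →₀ ℕ | (∑ i, w i) = (∑ i, (0 : Fin n →₀ ℕ) i) ∧
      (0 = w ∨ LexLT 0 w)} = {0} := by
    ext w
    constructor
    · rintro ⟨h, -⟩
      rw [← Finsupp.degree_eq_sum, ← Finsupp.degree_eq_sum, map_zero,
        Finsupp.degree_eq_zero_iff] at h
      exact h
    · rintro rfl
      exact ⟨rfl, Or.inl rfl⟩
  have hz : ∑ i, (0 : Fin n →₀ ℕ) i = 0 := by simp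
  rw [lexSet, Set.mem_ofPred_eq, hset, Set.ncard_singleton, hz, idealPiece_zero_eq_bot hJ,
    finrank_bot]
  omega

lemma lexSet_add_single (hJ : J ≠ ⊤) {v : Fin n →₀ ℕ} (hv : v ∈ lexSet J) (t : Fin n) :
    v + Finsupp.single t 1 ∈ lexSet J := by
  obtain ⟨k, hk⟩ : ∃ k, v.degree = k + 1 := by
    refine Nat.exists_eq_add_one_of_ne_zero fun h => ?_
    rw [Finsupp.degree_eq_zero_iff] at h
    exact zero_notMem_lexSet hJ (h ▸ hv)
  let u : Mon n (k + 2) := ⟨v + Finsupp.single t 1, by simp [hk]⟩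
  have hut : u.1 t ≠ 0 := by simp [u]
  have hdiv : divMon u t hut = ⟨v, hk⟩ := Subtype.ext (add_tsub_cancel_right _ _)
  change u.1 ∈ lexSet J
  rw [mem_lexSet_iff]
  by_contra hlt
  have h1 := (isPieceFamily_idealPiece J).codim_le k
  have h2 := (monRank_lt_consRank_iff u _).1 (lt_of_lt_of_le (not_le.1 hlt) h1) t hut
  rw [hdiv] at h2
  exact absurd ((mem_lexSet_iff ⟨v, hk⟩).1 hv) (not_le.2 h2)

lemma lexSet_mono (hJ : J ≠ ⊤) {u v : Fin n →₀ ℕ} (hu : u ∈ lexSet J) (huv : u ≤ v) :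
    v ∈ lexSet J := by
  obtain ⟨w, rfl⟩ := exists_add_of_le huv
  clear huv
  induction w using Finsupp.induction_linear generalizing u with
  | zero => rwa [add_zero]
  | add a b ha hb =>
    rw [← add_assoc]
    exact hb (ha hu)
  | single t m =>
    induction m with
    | zero => simpa
    | succ m ih =>
      rw [Finsupp.single_add, ← add_assoc]
      exact lexSet_add_single hJ ih t

lemma mem_lexIdeal_iff (hJ : J ≠ ⊤) {p : MvPolynomial (Fin n) K} :
    p ∈ LexIdeal J ↔ ∀ v ∈ p.support, v ∈ lexSet J := by
  rw [lexIdeal_eq_span, mem_ideal_span_monomial_image]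
  refine forall₂_congr fun v _ => ⟨?_, fun h => ⟨v, h, le_rfl⟩⟩
  rintro ⟨u, hu, huv⟩
  exact lexSet_mono hJ hu huv

lemma monomial_mem_idealPiece_lexIdeal (hJ : J ≠ ⊤) {k : ℕ} {v : Mon n k} (hv : v.1 ∈ lexSet J) :
    monomial v.1 (1 : K) ∈ idealPiece (LexIdeal J) (k : ℤ) := by
  rw [mem_idealPiece_natCast, mem_lexIdeal_iff hJ]
  refine ⟨fun u hu => ?_, isHomogeneous_monomial _ v.2⟩
  rw [Finset.mem_singleton.1 (support_monomial_subset hu)]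
  exact hv

/-- The lexicographic ideal has the same Hilbert function as the ideal. -/
lemma finrank_idealPiece_lexIdeal (hJ : J ≠ ⊤) (k : ℕ) :
    Module.finrank K (idealPiece (LexIdeal J) (k + 1 : ℕ)) =
      Module.finrank K (idealPiece J (k + 1 : ℕ)) := by
  have h : idealPiece (LexIdeal J) (k + 1 : ℕ) =
      restrictSupport K (Subtype.val '' {v : Mon n (k + 1) | codimPiece J (k + 1) ≤ monRank v}) := by
    ext p
    rw [mem_idealPiece_natCast, mem_lexIdeal_iff hJ, mem_restrictSupport_iff]
    constructor
    · rintro ⟨h1, h2⟩ v hv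
      have hdeg : v.degree = k + 1 := by
        have := h2 (mem_support_iff.1 hv)
        rw [Finsupp.degree_eq_weight_one]
        exact this
      exact ⟨⟨v, hdeg⟩, (mem_lexSet_iff ⟨v, hdeg⟩).1 (h1 v hv), rfl⟩
    · intro h
      constructor
      · intro v hv
        obtain ⟨u, hu, rfl⟩ := h hv
        exact (mem_lexSet_iff u).2 hu
      · intro v hv
        obtain ⟨u, hu, rfl⟩ := h (mem_support_iff.2 hv)
        exact (DFunLike.congr_fun Finsupp.degree_eq_weight_one u.1).symm.trans u.2
  rw [h, finrank_restrictSupport, Nat.card_coe_set_eq,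
    Set.ncard_image_of_injective _ Subtype.val_injective]
  have h1 := ncard_monRank_le_add (n := n) (k := k) (codimPiece_le J (k + 1))
  have h2 := finrank_idealPiece_le J (k + 1)
  rw [codimPiece] at h1 ⊢
  omega

/-- The lexicographic ideal has no minimal generators of degree `k + 1`. -/
def NoLexGen (J : Ideal (MvPolynomial (Fin n) K)) (k : ℕ) : Prop :=
  ∀ v : Mon n (k + 1), v.1 ∈ lexSet J → ∃ t, ∃ h : v.1 t ≠ 0, (divMon v t h).1 ∈ lexSet J

lemma noLexGen_of_gradedBetti_eq_zero (hJ : J ≠ ⊤) {k : ℕ}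
    (h : gradedBetti (LexIdeal J) 0 (k + 1 : ℤ) = 0) : NoLexGen J k := by
  intro v hv
  obtain ⟨p, hp, hsum⟩ := exists_eq_sum_of_gradedBetti_eq_zero h
    (p := monomial v.1 1) (by exact_mod_cast monomial_mem_idealPiece_lexIdeal hJ hv)
  have hne : ∑ t, coeff v.1 (X t * p t) ≠ 0 := by
    rw [← coeff_sum, ← hsum, coeff_monomial, if_pos rfl]
    exact one_ne_zero
  obtain ⟨t, -, ht⟩ := Finset.exists_ne_zero_of_sum_ne_zero hne
  rw [coeff_X_mul'] at ht
  split_ifs at ht with hvt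
  · refine ⟨t, Finsupp.mem_support_iff.1 hvt, ?_⟩
    exact (mem_lexIdeal_iff hJ).1 (mem_idealPiece_natCast.1 (hp t)).1 _ (mem_support_iff.2 ht)
  · exact absurd rfl ht

lemma consRank_codimPiece_le {k : ℕ} (h : NoLexGen J (k + 1)) :
    consRank k (codimPiece J (k + 1)) ≤ codimPiece J (k + 2) := by
  by_contra hlt
  rw [not_le] at hlt
  rcases (codimPiece_le J (k + 2)).lt_or_eq with hc | hc
  · obtain ⟨v, hv⟩ := mem_range_monRank.2 hc
    obtain ⟨t, ht, hdiv⟩ := h v ((mem_lexSet_iff v).2 hv.ge)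
    rw [← hv, monRank_lt_consRank_iff] at hlt
    exact absurd ((mem_lexSet_iff _).1 hdiv) (not_le.2 (hlt t ht))
  · have h1 := (consRank_strictMono k).monotone (codimPiece_le J (k + 1))
    have h2 := consRank_numMon_le n k
    omega

lemma exists_forall_noLexGen (hJ : J ≠ ⊤) : ∃ k₀, ∀ k, k₀ ≤ k → NoLexGen J k := by
  let A : ℕ →o Ideal (MvPolynomial (Fin n) K) :=
    ⟨fun k => Ideal.span ((fun v => monomial v (1 : K)) '' {v | v ∈ lexSet J ∧ v.degree ≤ k}),
      fun a b hab => Ideal.span_mono (Set.image_mono fun v hv => ⟨hv.1, hv.2.trans hab⟩)⟩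
  obtain ⟨k₀, hk₀⟩ := monotone_stabilizes_iff_noetherian.2 inferInstance A
  refine ⟨k₀, fun k hk v hv => ?_⟩
  have h1 : monomial v.1 (1 : K) ∈ A (k + 1) :=
    Ideal.subset_span ⟨v.1, ⟨hv, v.2.le⟩, rfl⟩
  rw [← hk₀ (k + 1) (by omega), hk₀ k hk] at h1
  obtain ⟨u, ⟨hu, hudeg⟩, huv⟩ := mem_ideal_span_monomial_image.1 h1 v.1 (by
    rw [mem_support_iff, coeff_monomial, if_pos rfl]
    exact one_ne_zero)
  obtain ⟨t, ht⟩ : ∃ t, u t < v.1 t := by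
    by_contra! hle
    have := le_antisymm huv hle
    rw [this, v.2] at hudeg
    omega
  refine ⟨t, by omega, lexSet_mono hJ hu fun i => ?_⟩
  change u i ≤ (v.1 - Finsupp.single t 1 : Fin n →₀ ℕ) i
  have := huv i
  rw [Finsupp.tsub_apply, Finsupp.single_apply]
  split_ifs with h
  · subst h
    omega
  · omega

lemma gradedBetti_lexIdeal_eq_zero (hJ : J ≠ ⊤) {i k : ℕ} {j : ℤ} (hj : j - (i : ℕ) = (k + 2 : ℕ))
    (h : NoLexGen J (k + 1)) : gradedBetti (LexIdeal J) i j = 0 := by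
  refine gradedBetti_eq_zero_of_exact fun z hz _ hbz => ?_
  obtain ⟨w, hw, hzw⟩ := (isPieceFamily_idealPiece (LexIdeal J)).exists_eq_polyBdry k (by
      rw [finrank_idealPiece_lexIdeal hJ, finrank_idealPiece_lexIdeal hJ]
      exact consRank_codimPiece_le h) (z := z) (fun s => by
      rw [← hj]
      exact hz s) hbz
  refine ⟨w, fun s => ?_, hzw⟩
  rw [show j - ((i + 1 : ℕ) : ℤ) = ((k + 1 : ℕ) : ℤ) by push_cast at hj ⊢; omega]
  exact hw s

lemma bddAbove_reg_lexIdeal (hJ : J ≠ ⊤) :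
    BddAbove {r : ℤ | ∃ (i : ℕ) (j : ℤ), gradedBetti (LexIdeal J) i j ≠ 0 ∧ r = j - i} := by
  obtain ⟨k₀, hk₀⟩ := exists_forall_noLexGen hJ
  refine ⟨k₀ + 1, ?_⟩
  rintro r ⟨i, j, hne, rfl⟩
  by_contra hlt
  obtain ⟨k, hk⟩ : ∃ k : ℕ, j - (i : ℕ) = (k + 2 : ℕ) :=
    ⟨(j - i - 2).toNat, by omega⟩
  exact hne (gradedBetti_lexIdeal_eq_zero hJ hk (hk₀ _ (by omega)))

lemma reg_lexIdeal_nonneg (hJ : J ≠ ⊤) : 0 ≤ reg (LexIdeal J) := by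
  rw [reg]
  rcases Set.eq_empty_or_nonempty
    {r : ℤ | ∃ (i : ℕ) (j : ℤ), gradedBetti (LexIdeal J) i j ≠ 0 ∧ r = j - i} with h | ⟨r, hr⟩
  · rw [h, Int.csSup_empty]
  · refine le_trans ?_ (le_csSup (bddAbove_reg_lexIdeal hJ) hr)
    obtain ⟨i, j, hne, rfl⟩ := hr
    by_contra hlt
    exact hne (gradedBetti_eq_zero_of_eq_bot (idealPiece_eq_bot_of_neg _ (not_le.1 hlt)))

lemma noLexGen_of_reg_le (hJ : J ≠ ⊤) {k : ℕ} (hk : reg (LexIdeal J) ≤ k) : NoLexGen J k := by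
  refine noLexGen_of_gradedBetti_eq_zero hJ ?_
  by_contra hne
  have := le_csSup (bddAbove_reg_lexIdeal hJ) ⟨0, (k + 1 : ℤ), hne, rfl⟩
  rw [← reg] at this
  push_cast at this
  omega

/-- Beyond the regularity of the lexicographic ideal, the Koszul complex of any family of pieces
with the same Hilbert function is exact. -/
theorem exists_eq_polyBdry_of_reg_lexIdeal_le (hJ : J ≠ ⊤)
    {W : ℕ → Submodule K (MvPolynomial (Fin n) K)} (hW : IsPieceFamily W)
    (hfin : ∀ k, Module.finrank K (W k) = Module.finrank K (idealPiece J (k : ℤ)))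
    {k : ℕ} (hk : reg (LexIdeal J) ≤ k) {z : Finset (Fin n) → MvPolynomial (Fin n) K}
    (hz : ∀ s, z s ∈ W (k + 1)) (hbz : ∀ s, polyBdry z s = 0) :
    ∃ w : Finset (Fin n) → MvPolynomial (Fin n) K,
      (∀ s, w s ∈ W k) ∧ ∀ s, z s = polyBdry w s := by
  have hgen := noLexGen_of_reg_le hJ hk
  rcases k with _ | k
  · have hcod : codimPiece J 1 = numMon n 1 := by
      refine le_antisymm (codimPiece_le J 1) (not_lt.1 fun hlt => ?_)
      obtain ⟨v, hv⟩ := mem_range_monRank.2 hlt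
      obtain ⟨t, ht, hdiv⟩ := hgen v ((mem_lexSet_iff v).2 hv.ge)
      rw [Finsupp.degree_eq_zero_iff _ |>.1 (divMon v t ht).2] at hdiv
      exact zero_notMem_lexSet hJ hdiv
    have hle := finrank_idealPiece_le J 1
    have hzero : Module.finrank K (W 1) = 0 := by
      rw [hfin]
      rw [codimPiece] at hcod
      omega
    have : FiniteDimensional K (W 1) := Submodule.finiteDimensional_of_le (hW.le_homogeneous 1)
    rw [Submodule.finrank_eq_zero] at hzero
    refine ⟨0, fun s => Submodule.zero_mem _, fun s => ?_⟩
    have := hz s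
    rw [zero_add, hzero, Submodule.mem_bot] at this
    simp [this, polyBdry]
  · refine hW.exists_eq_polyBdry k ?_ hz hbz
    rw [hfin, hfin]
    exact consRank_codimPiece_le hgen

end Lex

section InitialForms

variable {n : ℕ} (w : Fin n → ℕ)

/-- Polynomials of weight less than `b`. -/
noncomputable def weightLT (K : Type) [Field K] (b : ℕ) : Submodule K (MvPolynomial (Fin n) K) :=
  restrictSupport K {v | Finsupp.weight w v < b}

/-- The span of the top weight components of the elements of a space of polynomials. -/
noncomputable def initialSpace (V : Submodule K (MvPolynomial (Fin n) K)) :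
    Submodule K (MvPolynomial (Fin n) K) :=
  ⨅ b, ((V ⊓ weightLT w K (b + 1)).map (weightedHomogeneousComponent w b)).comap
    (weightedHomogeneousComponent w b)

variable {w}

lemma mem_weightLT {b : ℕ} {p : MvPolynomial (Fin n) K} :
    p ∈ weightLT w K b ↔ ∀ v, coeff v p ≠ 0 → Finsupp.weight w v < b := by
  rw [weightLT, mem_restrictSupport_iff]
  exact forall_congr' fun v => by rw [Finset.mem_coe, mem_support_iff]; rfl

lemma mem_initialSpace {V : Submodule K (MvPolynomial (Fin n) K)} {p : MvPolynomial (Fin n) K} :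
    p ∈ initialSpace w V ↔ ∀ b, ∃ q ∈ V, q ∈ weightLT w K (b + 1) ∧
      weightedHomogeneousComponent w b q = weightedHomogeneousComponent w b p := by
  simp only [initialSpace, Submodule.mem_iInf, Submodule.mem_comap, Submodule.mem_map,
    Submodule.mem_inf, and_assoc]

lemma weightLT_succ_inf_ker (b : ℕ) :
    weightLT w K (b + 1) ⊓ LinearMap.ker (weightedHomogeneousComponent w b) = weightLT w K b := by
  classical
  ext p
  rw [Submodule.mem_inf, LinearMap.mem_ker, mem_weightLT, mem_weightLT]
  constructor
  · rintro ⟨h1, h2⟩ v hv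
    refine lt_of_le_of_ne (Nat.lt_succ_iff.1 (h1 v hv)) fun h => hv ?_
    have := coeff_weightedHomogeneousComponent (w := w) b p v
    rw [if_pos h, h2, coeff_zero] at this
    exact this.symm
  · refine fun h => ⟨fun v hv => (h v hv).trans (Nat.lt_succ_self b), ?_⟩
    ext v
    rw [coeff_weightedHomogeneousComponent, coeff_zero]
    split_ifs with hb
    · by_contra hv
      exact (h v hv).ne hb
    · rfl

lemma weightedHomogeneousComponent_component (b c : ℕ) (p : MvPolynomial (Fin n) K) :
    weightedHomogeneousComponent w c (weightedHomogeneousComponent w b p) =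
      if b = c then weightedHomogeneousComponent w b p else 0 := by
  classical
  ext v
  rw [coeff_weightedHomogeneousComponent, coeff_weightedHomogeneousComponent]
  split_ifs with h1 h2 h3 h3 h2
  · rw [coeff_weightedHomogeneousComponent, if_pos h2]
  · exact absurd (h2.symm.trans h1) h3
  · rw [coeff_weightedHomogeneousComponent, if_neg h2]
  · rw [coeff_zero]
  · rw [coeff_weightedHomogeneousComponent, if_neg (h2 ▸ h1)]
  · rw [coeff_zero]

lemma weightedHomogeneousComponent_mem_weightLT {b : ℕ} (p : MvPolynomial (Fin n) K) :
    weightedHomogeneousComponent w b p ∈ weightLT w K (b + 1) := by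
  classical
  rw [mem_weightLT]
  intro v hv
  rw [coeff_weightedHomogeneousComponent] at hv
  split_ifs at hv with h
  · omega
  · exact absurd rfl hv

lemma map_initialSpace_inf (V : Submodule K (MvPolynomial (Fin n) K)) (b : ℕ) :
    (initialSpace w V ⊓ weightLT w K (b + 1)).map (weightedHomogeneousComponent w b) =
      (V ⊓ weightLT w K (b + 1)).map (weightedHomogeneousComponent w b) := by
  apply le_antisymm
  · rintro _ ⟨p, ⟨hp, -⟩, rfl⟩
    obtain ⟨q, hq, hqb, h⟩ := mem_initialSpace.1 hp b
    exact ⟨q, ⟨hq, hqb⟩, h⟩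
  · rintro _ ⟨q, ⟨hq, hqb⟩, rfl⟩
    refine ⟨weightedHomogeneousComponent w b q,
      ⟨mem_initialSpace.2 fun c => ?_, weightedHomogeneousComponent_mem_weightLT q⟩, ?_⟩
    · rw [weightedHomogeneousComponent_component]
      split_ifs with h
      · subst h
        exact ⟨q, hq, hqb, rfl⟩
      · exact ⟨0, Submodule.zero_mem _, Submodule.zero_mem _, map_zero _⟩
    · rw [weightedHomogeneousComponent_component, if_pos rfl]

lemma initialSpace_le_homogeneousSubmodule {V : Submodule K (MvPolynomial (Fin n) K)} {k : ℕ}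
    (hV : V ≤ homogeneousSubmodule (Fin n) K k) :
    initialSpace w V ≤ homogeneousSubmodule (Fin n) K k := by
  classical
  intro p hp v hv
  obtain ⟨q, hq, -, h⟩ := mem_initialSpace.1 hp (Finsupp.weight w v)
  refine hV hq fun h0 => hv ?_
  have h1 := congrArg (coeff v) h
  rw [coeff_weightedHomogeneousComponent, coeff_weightedHomogeneousComponent, if_pos rfl,
    if_pos rfl, h0] at h1
  exact h1.symm

lemma finrank_map_add_finrank_inf_ker {V V' : Type} [AddCommGroup V] [Module K V]
    [AddCommGroup V'] [Module K V'] (A : Submodule K V) [FiniteDimensional K A] (f : V →ₗ[K] V') :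
    Module.finrank K (A.map f) + Module.finrank K (A ⊓ LinearMap.ker f : Submodule K V) =
      Module.finrank K A := by
  rw [← LinearMap.finrank_range_add_finrank_ker (f.domRestrict A), LinearMap.range_domRestrict,
    LinearMap.ker_domRestrict]
  rw [← Submodule.map_comap_subtype]
  exact congrArg _ (Submodule.equivMapOfInjective A.subtype
    (Submodule.injective_subtype A) _).symm.finrank_eq

lemma finrank_initialSpace_inf {V : Submodule K (MvPolynomial (Fin n) K)} {k : ℕ}
    (hV : V ≤ homogeneousSubmodule (Fin n) K k) (b : ℕ) :
    Module.finrank K (initialSpace w V ⊓ weightLT w K b : Submodule K (MvPolynomial (Fin n) K)) =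
      Module.finrank K (V ⊓ weightLT w K b : Submodule K (MvPolynomial (Fin n) K)) := by
  induction b with
  | zero =>
    have h0 : weightLT w K 0 = ⊥ := by
      rw [eq_bot_iff]
      intro p hp
      rw [Submodule.mem_bot]
      ext v
      by_contra hv
      exact absurd (mem_weightLT.1 hp v hv) (Nat.not_lt_zero _)
    rw [h0, inf_bot_eq, inf_bot_eq]
  | succ b ih =>
    have : FiniteDimensional K
        (V ⊓ weightLT w K (b + 1) : Submodule K (MvPolynomial (Fin n) K)) :=
      Submodule.finiteDimensional_of_le (inf_le_left.trans hV)
    have : FiniteDimensional K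
        (initialSpace w V ⊓ weightLT w K (b + 1) : Submodule K (MvPolynomial (Fin n) K)) :=
      Submodule.finiteDimensional_of_le
        (inf_le_left.trans (initialSpace_le_homogeneousSubmodule hV))
    rw [← finrank_map_add_finrank_inf_ker _ (weightedHomogeneousComponent w b),
      ← finrank_map_add_finrank_inf_ker (V ⊓ _) (weightedHomogeneousComponent w b),
      map_initialSpace_inf, inf_assoc, inf_assoc, weightLT_succ_inf_ker, ih]

/-- Passing to initial forms preserves the dimension. -/
lemma finrank_initialSpace {V : Submodule K (MvPolynomial (Fin n) K)} {k : ℕ}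
    (hV : V ≤ homogeneousSubmodule (Fin n) K k) :
    Module.finrank K (initialSpace w V) = Module.finrank K V := by
  obtain ⟨b, hb⟩ : ∃ b, homogeneousSubmodule (Fin n) K k ≤ weightLT w K b := by
    obtain ⟨b, hb⟩ := (Set.finite_range fun v : Mon n k => Finsupp.weight w v.1).bddAbove
    refine ⟨b + 1, fun p hp => mem_weightLT.2 fun v hv => Nat.lt_succ_iff.2 (hb ⟨⟨v, ?_⟩, rfl⟩)⟩
    rw [Finsupp.degree_eq_weight_one]
    exact hp hv
  have h := finrank_initialSpace_inf (w := w) hV b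
  rwa [inf_eq_left.2 (hV.trans hb),
    inf_eq_left.2 ((initialSpace_le_homogeneousSubmodule hV).trans hb)] at h

lemma weightedHomogeneousComponent_X_mul (t : Fin n) (b : ℕ) (p : MvPolynomial (Fin n) K) :
    weightedHomogeneousComponent w b (X t * p) =
      if w t ≤ b then X t * weightedHomogeneousComponent w (b - w t) p else 0 := by
  classical
  have key : ∀ v : Fin n →₀ ℕ, t ∈ v.support →
      Finsupp.weight w (v - Finsupp.single t 1) + w t = Finsupp.weight w v := by
    intro v hv
    have hle : Finsupp.single t 1 ≤ v := by
      rw [Finsupp.single_le_iff]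
      exact Nat.one_le_iff_ne_zero.2 (Finsupp.mem_support_iff.1 hv)
    conv_rhs => rw [← tsub_add_cancel_of_le hle]
    rw [map_add, Finsupp.weight_single, one_smul]
  ext v
  rw [coeff_weightedHomogeneousComponent, coeff_X_mul']
  split_ifs with h1 h2 h3 h3 h3
  · rw [coeff_X_mul', if_pos h2, coeff_weightedHomogeneousComponent, if_pos]
    have := key v h2
    omega
  · have := key v h2
    omega
  · rw [coeff_X_mul', if_neg h2]
  · rw [coeff_zero]
  · rw [coeff_X_mul']
    split_ifs with h2
    · rw [coeff_weightedHomogeneousComponent, if_neg]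
      have := key v h2
      omega
    · rfl
  · rw [coeff_zero]

lemma X_mul_mem_initialSpace {V V' : Submodule K (MvPolynomial (Fin n) K)} {t : Fin n}
    (h : ∀ q ∈ V, X t * q ∈ V') {p : MvPolynomial (Fin n) K} (hp : p ∈ initialSpace w V) :
    X t * p ∈ initialSpace w V' := by
  classical
  rw [mem_initialSpace]
  intro b
  by_cases hb : w t ≤ b
  · obtain ⟨q, hq, hqb, hqp⟩ := mem_initialSpace.1 hp (b - w t)
    refine ⟨X t * q, h q hq, mem_weightLT.2 fun v hv => ?_, ?_⟩
    · rw [coeff_X_mul'] at hv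
      split_ifs at hv with hvt
      · have hle : Finsupp.single t 1 ≤ v := by
          rw [Finsupp.single_le_iff]
          exact Nat.one_le_iff_ne_zero.2 (Finsupp.mem_support_iff.1 hvt)
        have h1 := mem_weightLT.1 hqb _ hv
        rw [← tsub_add_cancel_of_le hle, map_add, Finsupp.weight_single, one_smul]
        omega
      · exact absurd rfl hv
    · rw [weightedHomogeneousComponent_X_mul, weightedHomogeneousComponent_X_mul, hqp]
  · refine ⟨0, Submodule.zero_mem _, Submodule.zero_mem _, ?_⟩
    rw [weightedHomogeneousComponent_X_mul, if_neg hb, map_zero]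

lemma isPieceFamily_initialSpace {W : ℕ → Submodule K (MvPolynomial (Fin n) K)}
    (hW : IsPieceFamily W) : IsPieceFamily (fun k => initialSpace w (W k)) :=
  ⟨fun k => initialSpace_le_homogeneousSubmodule (hW.le_homogeneous k),
    fun k t _ hq => X_mul_mem_initialSpace (hW.X_mul_mem k t) hq⟩

end InitialForms

section Elimination

variable {n m : ℕ}

/-- The weight on `n + m` variables that counts the last `m` of them. -/
def lastWeight (n m : ℕ) : Fin (n + m) → ℕ :=
  Fin.addCases (fun _ => 0) (fun _ => 1)

/-- The indices in `s` among the first `n`. -/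
def castAddPreimage (s : Finset (Fin (n + m))) : Finset (Fin n) :=
  Finset.univ.filter fun t => Fin.castAdd m t ∈ s

lemma weight_lastWeight_mapDomain (u : Fin n →₀ ℕ) :
    Finsupp.weight (lastWeight n m) (u.mapDomain (Fin.castAdd m)) = 0 := by
  rw [Finsupp.weight_apply, Finsupp.sum_mapDomain_index (by simp) (fun _ _ _ => add_smul _ _ _)]
  simp [lastWeight]

lemma exists_mapDomain_eq_of_weight_lastWeight {v : Fin (n + m) →₀ ℕ}
    (hv : Finsupp.weight (lastWeight n m) v = 0) :
    ∃ u : Fin n →₀ ℕ, u.mapDomain (Fin.castAdd m) = v := by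
  refine ⟨_, Finsupp.mapDomain_comapDomain _ (Fin.castAdd_injective n m) v fun t ht => ?_⟩
  induction t using Fin.addCases with
  | left t => exact ⟨t, rfl⟩
  | right t =>
    have h := Finsupp.le_weight (lastWeight n m) (s := Fin.natAdd n t) (by simp [lastWeight]) v
    exact absurd (Nat.le_zero.1 (h.trans hv.le)) (Finsupp.mem_support_iff.1 ht)

lemma rename_killCompl (p : MvPolynomial (Fin (n + m)) K) :
    rename (Fin.castAdd m) (killCompl (Fin.castAdd_injective n m) p) =
      weightedHomogeneousComponent (lastWeight n m) 0 p := by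
  classical
  ext v
  rw [coeff_weightedHomogeneousComponent]
  split_ifs with hv
  · obtain ⟨u, rfl⟩ := exists_mapDomain_eq_of_weight_lastWeight hv
    rw [coeff_rename_mapDomain _ (Fin.castAdd_injective n m), coeff_killCompl]
  · refine coeff_rename_eq_zero _ _ _ fun u hu => absurd ?_ hv
    rw [← hu, weight_lastWeight_mapDomain]

lemma rename_castAdd_mem_initialSpace {V : Submodule K (MvPolynomial (Fin (n + m)) K)}
    {p : MvPolynomial (Fin n) K} (hp : rename (Fin.castAdd m) p ∈ V) :
    rename (Fin.castAdd m) p ∈ initialSpace (lastWeight n m) V := by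
  classical
  have h0 : ∀ v, coeff v (rename (Fin.castAdd m) p) ≠ 0 →
      Finsupp.weight (lastWeight n m) v = 0 := by
    intro v hv
    obtain ⟨u, rfl, -⟩ := coeff_rename_ne_zero _ _ _ hv
    exact weight_lastWeight_mapDomain u
  exact mem_initialSpace.2 fun b => ⟨_, hp, mem_weightLT.2 fun v hv => by rw [h0 v hv]; omega, rfl⟩

lemma rename_killCompl_mem {V : Submodule K (MvPolynomial (Fin (n + m)) K)}
    {p : MvPolynomial (Fin (n + m)) K} (hp : p ∈ initialSpace (lastWeight n m) V) :
    rename (Fin.castAdd m) (killCompl (Fin.castAdd_injective n m) p) ∈ V := by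
  classical
  obtain ⟨q, hq, hq0, h⟩ := mem_initialSpace.1 hp 0
  rw [rename_killCompl, ← h]
  convert hq using 1
  ext v
  rw [coeff_weightedHomogeneousComponent]
  split_ifs with hv
  · rfl
  · by_contra hc
    exact hv (Nat.lt_one_iff.1 (mem_weightLT.1 hq0 v (Ne.symm hc)))

lemma koszulSign_map_castAdd (t : Fin n) (s : Finset (Fin n)) :
    koszulSign K (Fin.castAdd m t) (s.map (Fin.castAddEmb m)) = koszulSign K t s := by
  rw [koszulSign, koszulSign, Finset.filter_map, Finset.card_map]
  rfl

lemma castAddPreimage_map (s : Finset (Fin n)) :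
    castAddPreimage (s.map (Fin.castAddEmb m)) = s := by
  ext t
  simp [castAddPreimage]

/-- Transport a Koszul chain to a polynomial ring with more variables. -/
noncomputable def renameChain (m : ℕ) (z : Finset (Fin n) → MvPolynomial (Fin n) K)
    (s : Finset (Fin (n + m))) : MvPolynomial (Fin (n + m)) K :=
  if s = (castAddPreimage s).map (Fin.castAddEmb m) then
    rename (Fin.castAdd m) (z (castAddPreimage s)) else 0

lemma renameChain_map (z : Finset (Fin n) → MvPolynomial (Fin n) K) (s : Finset (Fin n)) :
    renameChain m z (s.map (Fin.castAddEmb m)) = rename (Fin.castAdd m) (z s) := by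
  rw [renameChain, castAddPreimage_map, if_pos rfl]

lemma renameChain_of_natAdd_mem (z : Finset (Fin n) → MvPolynomial (Fin n) K)
    {s : Finset (Fin (n + m))} {t : Fin m} (ht : Fin.natAdd n t ∈ s) : renameChain m z s = 0 := by
  rw [renameChain, if_neg]
  intro h
  rw [h, Finset.mem_map] at ht
  obtain ⟨u, -, hu⟩ := ht
  exact absurd (congrArg Fin.val hu) (by simp; omega)

lemma eq_map_castAdd_or_natAdd_mem (s : Finset (Fin (n + m))) :
    (∃ r : Finset (Fin n), s = r.map (Fin.castAddEmb m)) ∨ ∃ t : Fin m, Fin.natAdd n t ∈ s := by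
  by_cases h : ∃ t : Fin m, Fin.natAdd n t ∈ s
  · exact Or.inr h
  · refine Or.inl ⟨castAddPreimage s, ?_⟩
    ext t
    induction t using Fin.addCases with
    | left t => simp [castAddPreimage]
    | right t =>
      refine ⟨fun ht => absurd ⟨t, ht⟩ h, fun ht => ?_⟩
      obtain ⟨u, -, hu⟩ := Finset.mem_map.1 ht
      exact absurd (congrArg Fin.val hu) (by simp; omega)

lemma sum_compl_map_castAdd {A : Type} [AddCommMonoid A] (s : Finset (Fin n))
    (g : Fin (n + m) → A) (hg : ∀ t : Fin m, g (Fin.natAdd n t) = 0) :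
    ∑ t ∈ (s.map (Fin.castAddEmb m))ᶜ, g t = ∑ t ∈ sᶜ, g (Fin.castAdd m t) := by
  have h : ∑ t ∈ sᶜ, g (Fin.castAdd m t) = ∑ t ∈ sᶜ.map (Fin.castAddEmb m), g t := by
    rw [Finset.sum_map]
    rfl
  rw [h]
  symm
  apply Finset.sum_subset
  · intro t ht
    obtain ⟨u, hu, rfl⟩ := Finset.mem_map.1 ht
    simpa using hu
  · intro t ht ht'
    induction t using Fin.addCases with
    | left t => simp_all
    | right t => exact hg t

lemma polyBdry_renameChain_map (z : Finset (Fin n) → MvPolynomial (Fin n) K)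
    (s : Finset (Fin n)) : polyBdry (renameChain m z) (s.map (Fin.castAddEmb m)) =
      rename (Fin.castAdd m) (polyBdry z s) := by
  rw [polyBdry, polyBdry, map_sum, sum_compl_map_castAdd]
  · refine Finset.sum_congr rfl fun t _ => ?_
    have : insert (Fin.castAdd m t) (s.map (Fin.castAddEmb m)) =
        (insert t s).map (Fin.castAddEmb m) := by
      rw [Finset.map_insert]
      rfl
    rw [koszulSign_map_castAdd, this, renameChain_map, map_smul, map_mul, rename_X]
  · intro t
    rw [renameChain_of_natAdd_mem z (Finset.mem_insert_self _ _), mul_zero, smul_zero]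

lemma polyBdry_renameChain_of_natAdd_mem (z : Finset (Fin n) → MvPolynomial (Fin n) K)
    {s : Finset (Fin (n + m))} {t : Fin m} (ht : Fin.natAdd n t ∈ s) :
    polyBdry (renameChain m z) s = 0 :=
  Finset.sum_eq_zero fun u _ => by
    rw [renameChain_of_natAdd_mem z (Finset.mem_insert_of_mem ht), mul_zero, smul_zero]

/-- Setting the last variables to zero commutes with the Koszul differential. -/
lemma killCompl_polyBdry_map (z : Finset (Fin (n + m)) → MvPolynomial (Fin (n + m)) K)
    (s : Finset (Fin n)) :
    killCompl (Fin.castAdd_injective n m) (polyBdry z (s.map (Fin.castAddEmb m))) =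
      polyBdry (fun r => killCompl (Fin.castAdd_injective n m) (z (r.map (Fin.castAddEmb m)))) s := by
  have hX : ∀ t : Fin n, killCompl (Fin.castAdd_injective n m) (X (R := K) (Fin.castAdd m t)) =
      X t := fun t => by rw [← rename_X, killCompl_rename_app]
  have hY : ∀ t : Fin m, killCompl (Fin.castAdd_injective n m) (X (R := K) (Fin.natAdd n t)) =
      0 := by
    intro t
    rw [killCompl, aeval_X, dif_neg]
    rintro ⟨u, hu⟩
    exact absurd (congrArg Fin.val hu) (by simp; omega)
  rw [polyBdry, polyBdry, map_sum, sum_compl_map_castAdd]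
  · refine Finset.sum_congr rfl fun t _ => ?_
    rw [koszulSign_map_castAdd, map_smul, map_mul, hX, Finset.map_insert]
    rfl
  · intro t
    rw [map_smul, map_mul, hY, zero_mul, smul_zero]

lemma rename_castAdd_mem_idealPiece_iff {J : Ideal (MvPolynomial (Fin (n + m)) K)} {k : ℕ}
    {p : MvPolynomial (Fin n) K} :
    rename (Fin.castAdd m) p ∈ idealPiece J (k : ℤ) ↔
      p ∈ idealPiece (J.comap (rename (Fin.castAdd m))) (k : ℤ) := by
  rw [mem_idealPiece_natCast, mem_idealPiece_natCast,
    IsHomogeneous.rename_isHomogeneous_iff (Fin.castAdd_injective n m)]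
  rfl

/-- Koszul cycles over an elimination ideal bound in all degrees beyond the regularity of the
lexicographic ideal. -/
theorem exists_eq_polyBdry_comap {J : Ideal (MvPolynomial (Fin (n + m)) K)} (hJ : J ≠ ⊤)
    {k : ℕ} (hk : reg (LexIdeal J) ≤ k) {z : Finset (Fin n) → MvPolynomial (Fin n) K}
    (hz : ∀ s, z s ∈ idealPiece (J.comap (rename (Fin.castAdd m))) ((k + 1 : ℕ) : ℤ))
    (hbz : ∀ s, polyBdry z s = 0) :
    ∃ w : Finset (Fin n) → MvPolynomial (Fin n) K,
      (∀ s, w s ∈ idealPiece (J.comap (rename (Fin.castAdd m))) (k : ℤ)) ∧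
        ∀ s, z s = polyBdry w s := by
  have hz' : ∀ s, renameChain m z s ∈
      initialSpace (lastWeight n m) (idealPiece J ((k + 1 : ℕ) : ℤ)) := by
    intro s
    rcases eq_map_castAdd_or_natAdd_mem s with ⟨r, rfl⟩ | ⟨t, ht⟩
    · rw [renameChain_map]
      exact rename_castAdd_mem_initialSpace (rename_castAdd_mem_idealPiece_iff.2 (hz r))
    · rw [renameChain_of_natAdd_mem z ht]
      exact Submodule.zero_mem _
  have hbz' : ∀ s, polyBdry (renameChain m z) s = 0 := by
    intro s
    rcases eq_map_castAdd_or_natAdd_mem s with ⟨r, rfl⟩ | ⟨t, ht⟩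
    · rw [polyBdry_renameChain_map, hbz, map_zero]
    · exact polyBdry_renameChain_of_natAdd_mem z ht
  obtain ⟨w, hw, h⟩ := exists_eq_polyBdry_of_reg_lexIdeal_le hJ
    (isPieceFamily_initialSpace (w := lastWeight n m) (isPieceFamily_idealPiece J))
    (fun k => finrank_initialSpace ((isPieceFamily_idealPiece J).le_homogeneous k)) hk hz' hbz'
  refine ⟨fun s => killCompl (Fin.castAdd_injective n m) (w (s.map (Fin.castAddEmb m))),
    fun s => ?_, fun s => ?_⟩
  · rw [← rename_castAdd_mem_idealPiece_iff]
    exact rename_killCompl_mem (hw _)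
  · rw [← killCompl_polyBdry_map, ← h, renameChain_map, killCompl_rename_app]

end Elimination

section Extraction

variable {ℓ : ℕ}

/-- The affine map `v ↦ δ v + c` on exponents. -/
noncomputable def affineExponent (δ c : Fin ℓ → ℕ) (v : Fin ℓ →₀ ℕ) : Fin ℓ →₀ ℕ :=
  Finsupp.equivFunOnFinite.symm fun t => δ t * v t + c t

lemma affineExponent_apply (δ c : Fin ℓ → ℕ) (v : Fin ℓ →₀ ℕ) (t : Fin ℓ) :
    affineExponent δ c v t = δ t * v t + c t :=
  rfl

lemma affineExponent_injective {δ : Fin ℓ → ℕ} (hδ : ∀ t, 0 < δ t) (c : Fin ℓ → ℕ) :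
    Function.Injective (affineExponent δ c) := by
  intro v v' h
  ext t
  have := DFunLike.congr_fun h t
  rw [affineExponent_apply, affineExponent_apply, add_left_inj] at this
  exact Nat.eq_of_mul_eq_mul_left (hδ t) this

/-- The linear map picking out the coefficients at the exponents `δ v + c`. -/
noncomputable def extract {δ : Fin ℓ → ℕ} (hδ : ∀ t, 0 < δ t) (c : Fin ℓ → ℕ) :
    MvPolynomial (Fin ℓ) K →ₗ[K] MvPolynomial (Fin ℓ) K :=
  (AddMonoidAlgebra.coeffLinearEquiv K).symm.toLinearMap ∘ₗ
    Finsupp.lcomapDomain _ (affineExponent_injective hδ c) ∘ₗ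
      (AddMonoidAlgebra.coeffLinearEquiv K).toLinearMap

lemma coeff_extract {δ : Fin ℓ → ℕ} (hδ : ∀ t, 0 < δ t) (c : Fin ℓ → ℕ)
    (p : MvPolynomial (Fin ℓ) K) (v : Fin ℓ →₀ ℕ) :
    coeff v (extract hδ c p) = coeff (affineExponent δ c v) p :=
  rfl

/-- The extraction operators absorb powers of a variable. -/
lemma extract_X_pow_mul {δ : Fin ℓ → ℕ} (hδ : ∀ t, 0 < δ t) {c c' : Fin ℓ → ℕ} {t : Fin ℓ}
    {k : ℕ} (hc : ∀ u, u ≠ t → c' u = c u) (ht : c' t + k = δ t + c t) (hk : c t < k)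
    (p : MvPolynomial (Fin ℓ) K) :
    extract hδ c (X t ^ k * p) = X t * extract hδ c' p := by
  classical
  ext v
  rw [coeff_extract, coeff_X_mul', X_pow_eq_monomial, coeff_monomial_mul', one_mul]
  simp only [Finsupp.single_le_iff, affineExponent_apply, Finsupp.mem_support_iff]
  rcases Nat.eq_zero_or_pos (v t) with hv | hv
  · rw [if_neg (by rw [hv]; omega), if_neg (not_not.2 hv)]
  · obtain ⟨a, ha⟩ := Nat.exists_eq_add_of_lt hv
    have ha' : δ t * v t = δ t * a + δ t := by rw [ha]; ring
    rw [if_pos (by omega), if_pos hv.ne', coeff_extract]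
    congr 1
    ext u
    rw [Finsupp.tsub_apply, affineExponent_apply, affineExponent_apply, Finsupp.tsub_apply]
    by_cases hu : u = t
    · subst hu
      rw [Finsupp.single_eq_same, Finsupp.single_eq_same, show v u - 1 = a by omega]
      omega
    · rw [Finsupp.single_eq_of_ne hu, Finsupp.single_eq_of_ne hu, hc u hu]
      rfl

lemma extract_isHomogeneous {d : ℕ} (hd : 0 < d) {c : Fin ℓ → ℕ} {a : ℕ}
    {p : MvPolynomial (Fin ℓ) K} (hp : p.IsHomogeneous (d * a + ∑ t, c t)) :
    (extract (fun _ => hd) c p).IsHomogeneous a := by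
  intro v hv
  rw [coeff_extract] at hv
  have h := hp hv
  rw [← Pi.one_def.symm, ← Finsupp.degree_eq_weight_one, Finsupp.degree_eq_sum] at h ⊢
  simp only [affineExponent_apply, Finset.sum_add_distrib, ← Finset.mul_sum] at h
  exact Nat.eq_of_mul_eq_mul_left hd (Nat.add_right_cancel h)

lemma extract_monomial_mul_expand {d : ℕ} (hd : 0 < d) (c : Fin ℓ → ℕ)
    (p : MvPolynomial (Fin ℓ) K) :
    extract (fun _ => hd) c (monomial (Finsupp.equivFunOnFinite.symm c) 1 * expand d p) = p := by
  ext v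
  have h : affineExponent (fun _ => d) c v = Finsupp.equivFunOnFinite.symm c + d • v := by
    ext t
    simp [affineExponent_apply, add_comm]
  rw [coeff_extract, h, coeff_monomial_mul, one_mul, coeff_expand_smul d hd.ne']

end Extraction

section Substitution

variable {n m : ℕ}

/-- The constant function `d - 1` on `s`, extended by zero. -/
def predOn (d : ℕ) (s : Finset (Fin n)) (t : Fin n) : ℕ :=
  if t ∈ s then d - 1 else 0

lemma sum_predOn (d : ℕ) (s : Finset (Fin n)) : ∑ t, predOn d s t = (d - 1) * s.card := by
  simp [predOn, mul_comm]

/-- A Koszul chain pulled back along the substitution of `d`-th powers of the variables. -/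
noncomputable def expandChain (d : ℕ) (z : Finset (Fin n) → MvPolynomial (Fin n) K)
    (s : Finset (Fin n)) : MvPolynomial (Fin n) K :=
  monomial (Finsupp.equivFunOnFinite.symm (predOn d s)) 1 * expand d (z s)

lemma polyBdry_expandChain {d : ℕ} (hd : 0 < d) (z : Finset (Fin n) → MvPolynomial (Fin n) K)
    (s : Finset (Fin n)) : polyBdry (expandChain d z) s =
      monomial (Finsupp.equivFunOnFinite.symm (predOn d s)) 1 * expand d (polyBdry z s) := by
  rw [polyBdry, polyBdry, map_sum, Finset.mul_sum]
  refine Finset.sum_congr rfl fun t ht => ?_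
  have hts : t ∉ s := by simpa using ht
  rw [expandChain, map_smul, map_mul, expand_X, mul_smul_comm, ← mul_assoc, ← mul_assoc]
  congr 2
  rw [X_pow_eq_monomial, X, monomial_mul, monomial_mul]
  refine congrArg (fun v => monomial v (1 * 1)) (Finsupp.ext fun u => ?_)
  by_cases hu : u = t
  · subst hu
    simp [predOn, hts]
    omega
  · simp [predOn, hu]

lemma expand_isHomogeneous {d k : ℕ} {p : MvPolynomial (Fin n) K} (hp : p.IsHomogeneous k) :
    (expand d p).IsHomogeneous (d * k) :=
  hp.aeval _ fun i => isHomogeneous_X_pow i d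

lemma expandChain_isHomogeneous {d k : ℕ} {z : Finset (Fin n) → MvPolynomial (Fin n) K}
    {s : Finset (Fin n)} (hz : (z s).IsHomogeneous k) :
    (expandChain d z s).IsHomogeneous (d * k + (d - 1) * s.card) := by
  rw [add_comm, ← sum_predOn]
  refine IsHomogeneous.mul (isHomogeneous_monomial _ ?_) (expand_isHomogeneous hz)
  rw [Finsupp.degree_eq_sum]
  rfl

/-- The ideal generated by the forms `x_i ^ d - f_i`. -/
noncomputable def graphIdeal (d : ℕ) (f : Fin n → MvPolynomial (Fin m) K) :
    Ideal (MvPolynomial (Fin (n + m)) K) :=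
  Ideal.span (Set.range fun i => X (Fin.castAdd m i) ^ d - rename (Fin.natAdd n) (f i))

lemma graphIdeal_ne_top {d : ℕ} (hd : 0 < d) {f : Fin n → MvPolynomial (Fin m) K}
    (hf : ∀ i, (f i).IsHomogeneous d) : graphIdeal d f ≠ ⊤ := by
  intro h
  have hle : graphIdeal d f ≤ RingHom.ker (constantCoeff (R := K) (σ := Fin (n + m))) := by
    rw [graphIdeal, Ideal.span_le]
    rintro _ ⟨i, rfl⟩
    have h0 : constantCoeff (f i) = 0 := (hf i).coeff_eq_zero (by simpa using hd.ne)
    simp [RingHom.mem_ker, h0, hd.ne']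
  exact RingHom.ker_ne_top _ (top_le_iff.1 (h ▸ hle))

lemma rename_expand_sub_mem_graphIdeal (d : ℕ) (f : Fin n → MvPolynomial (Fin m) K)
    (p : MvPolynomial (Fin n) K) :
    rename (Fin.castAdd m) (expand d p) - rename (Fin.natAdd n) (aeval f p) ∈ graphIdeal d f := by
  have h : ((Ideal.Quotient.mkₐ K (graphIdeal d f)).comp (rename (Fin.castAdd m))).comp
        (expand d) =
      ((Ideal.Quotient.mkₐ K (graphIdeal d f)).comp (rename (Fin.natAdd n))).comp (aeval f) := by
    refine algHom_ext fun i => ?_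
    simp only [AlgHom.comp_apply, expand_X, aeval_X, map_pow, rename_X]
    rw [← map_pow]
    exact Ideal.Quotient.eq.2 (Ideal.subset_span ⟨i, rfl⟩)
  exact Ideal.Quotient.eq.1 (DFunLike.congr_fun h p)

lemma expand_mem_comap_graphIdeal (d : ℕ) {f : Fin n → MvPolynomial (Fin m) K}
    {p : MvPolynomial (Fin n) K} (hp : aeval f p = 0) :
    expand d p ∈ (graphIdeal d f).comap (rename (Fin.castAdd m)) := by
  have h := rename_expand_sub_mem_graphIdeal d f p
  rwa [hp, map_zero, sub_zero] at h

lemma addCases_pos {d : ℕ} (hd : 0 < d) (t : Fin (n + m)) :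
    0 < Fin.addCases (motive := fun _ => ℕ) (fun _ : Fin n => d) (fun _ : Fin m => 1) t := by
  induction t using Fin.addCases with
  | left t => simpa using hd
  | right t => simp

/-- Extraction with respect to the first `n` of `n + m` variables. -/
noncomputable def extractLeft {d : ℕ} (hd : 0 < d) (c : Fin n → ℕ) :
    MvPolynomial (Fin (n + m)) K →ₗ[K] MvPolynomial (Fin (n + m)) K :=
  extract (addCases_pos hd) (Fin.addCases c fun _ => 0)

lemma extractLeft_rename_natAdd_mul {d : ℕ} (hd : 0 < d) (c : Fin n → ℕ)
    (g : MvPolynomial (Fin m) K) (p : MvPolynomial (Fin (n + m)) K) :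
    extractLeft hd c (rename (Fin.natAdd n) g * p) =
      rename (Fin.natAdd n) g * extractLeft hd c p := by
  induction g using MvPolynomial.induction_on generalizing p with
  | C a => rw [rename_C, C_mul', C_mul', map_smul]
  | add g g' h h' => rw [map_add, add_mul, add_mul, map_add, h, h']
  | mul_X g t h =>
    rw [map_mul (rename _), rename_X, mul_assoc, mul_assoc, h]
    congr 1
    rw [extractLeft, ← pow_one (X (Fin.natAdd n t)), extract_X_pow_mul (c' := Fin.addCases c _),
      pow_one]
    · exact fun _ _ => rfl
    · simp [add_comm]
    · simp

lemma extractLeft_X_castAdd_pow_mul {d : ℕ} (hd : 0 < d) {c : Fin n → ℕ} (hc : ∀ t, c t < d)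
    (t : Fin n) (p : MvPolynomial (Fin (n + m)) K) :
    extractLeft hd c (X (Fin.castAdd m t) ^ d * p) = X (Fin.castAdd m t) * extractLeft hd c p :=
  extract_X_pow_mul _ (fun _ _ => rfl) (by simp [add_comm]) (by simpa using hc t) p

lemma extractLeft_rename_castAdd {d : ℕ} (hd : 0 < d) (c : Fin n → ℕ)
    (p : MvPolynomial (Fin n) K) :
    extractLeft hd c (rename (Fin.castAdd m) p) =
      rename (Fin.castAdd m) (extract (fun _ => hd) c p) := by
  ext v
  have hval : ∀ (u : Fin n →₀ ℕ) (t : Fin m), u.mapDomain (Fin.castAdd m) (Fin.natAdd n t) = 0 :=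
    fun u t => Finsupp.mapDomain_of_notMem_range _ _ fun ⟨r, hr⟩ =>
      absurd (congrArg Fin.val hr) (by simp; omega)
  rw [extractLeft, coeff_extract]
  by_cases hv : ∃ u : Fin n →₀ ℕ, u.mapDomain (Fin.castAdd m) = v
  · obtain ⟨u, rfl⟩ := hv
    rw [coeff_rename_mapDomain _ (Fin.castAdd_injective n m), coeff_extract,
      ← coeff_rename_mapDomain _ (Fin.castAdd_injective n m)]
    congr 1
    ext t
    induction t using Fin.addCases with
    | left t =>
      simp [affineExponent_apply, Finsupp.mapDomain_apply (Fin.castAdd_injective n m)]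
    | right t => simp [affineExponent_apply, hval]
  · rw [coeff_rename_eq_zero _ _ _ fun u hu => absurd ⟨u, hu⟩ hv, coeff_rename_eq_zero]
    intro u hu
    refine absurd (exists_mapDomain_eq_of_weight_lastWeight ?_) hv
    rw [Finsupp.weight_apply, Finsupp.sum_fintype _ _ (by simp), Fin.sum_univ_add]
    have h0 : ∀ t, v (Fin.natAdd n t) = 0 := by
      intro t
      have h := DFunLike.congr_fun hu (Fin.natAdd n t)
      rw [hval, affineExponent_apply] at h
      simpa using h.symm
    simp [lastWeight, h0]

lemma extract_mem_ker {d : ℕ} (hd : 0 < d) {c : Fin n → ℕ} (hc : ∀ t, c t < d)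
    {f : Fin n → MvPolynomial (Fin m) K} {p : MvPolynomial (Fin n) K}
    (hp : p ∈ (graphIdeal d f).comap (rename (Fin.castAdd m))) :
    aeval f (extract (fun _ => hd) c p) = 0 := by
  let A : MvPolynomial (Fin (n + m)) K →ₐ[K] MvPolynomial (Fin m) K := aeval (Fin.addCases f X)
  have hAl : ∀ q : MvPolynomial (Fin n) K, A (rename (Fin.castAdd m) q) = aeval f q := by
    intro q
    rw [aeval_rename]
    congr 2
    ext1 t
    simp
  have hAr : ∀ q : MvPolynomial (Fin m) K, A (rename (Fin.natAdd n) q) = q := by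
    intro q
    rw [aeval_rename]
    have : (Fin.addCases f X : Fin (n + m) → MvPolynomial (Fin m) K) ∘ Fin.natAdd n = X := by
      ext1 t
      simp
    rw [this, aeval_X_left_apply]
  obtain ⟨b, hb⟩ := Ideal.mem_span_range_iff_exists_fun.1 (Ideal.mem_comap.1 hp)
  rw [← hAl, ← extractLeft_rename_castAdd, show rename (Fin.castAdd m) p = _ from hb.symm,
    map_sum, map_sum]
  refine Finset.sum_eq_zero fun i _ => ?_
  have h : A (X (Fin.castAdd m i)) - A (rename (Fin.natAdd n) (f i)) = 0 := by
    rw [← rename_X, hAl, hAr, aeval_X, sub_self]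
  have h' : extractLeft hd c (b i * (X (Fin.castAdd m i) ^ d - rename (Fin.natAdd n) (f i))) =
      (X (Fin.castAdd m i) - rename (Fin.natAdd n) (f i)) * extractLeft hd c (b i) := by
    rw [mul_comm, sub_mul, map_sub, extractLeft_X_castAdd_pow_mul hd hc,
      extractLeft_rename_natAdd_mul, ← sub_mul]
  exact (congrArg A h').trans (by rw [map_mul, map_sub, h, zero_mul])

end Substitution

section Transfer

variable {n m : ℕ}

lemma extract_X_mul_insert {d : ℕ} (hd : 0 < d) {t : Fin n} {s : Finset (Fin n)} (ht : t ∉ s)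
    (p : MvPolynomial (Fin n) K) :
    extract (fun _ => hd) (predOn d s) (X t * p) =
      X t * extract (fun _ => hd) (predOn d (insert t s)) p := by
  conv_lhs => rw [← pow_one (X t)]
  refine extract_X_pow_mul _ (fun u hu => ?_) ?_ ?_ p
  · simp [predOn, hu]
  · simp [predOn, ht]
    omega
  · simp [predOn, ht]

lemma extract_polyBdry {d : ℕ} (hd : 0 < d) (z : Finset (Fin n) → MvPolynomial (Fin n) K)
    (s : Finset (Fin n)) :
    extract (fun _ => hd) (predOn d s) (polyBdry z s) =
      polyBdry (fun r => extract (fun _ => hd) (predOn d r) (z r)) s := by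
  rw [polyBdry, polyBdry, map_sum]
  refine Finset.sum_congr rfl fun t ht => ?_
  rw [map_smul, extract_X_mul_insert hd (by simpa using ht)]

lemma polyBdry_eq_zero_of_card {i : ℕ} {z : Finset (Fin n) → MvPolynomial (Fin n) K}
    (hz : ∀ s, s.card ≠ i + 1 → z s = 0) {s : Finset (Fin n)} (hs : s.card ≠ i) :
    polyBdry z s = 0 :=
  Finset.sum_eq_zero fun t ht => by
    rw [hz, mul_zero, smul_zero]
    rw [Finset.card_insert_of_notMem (by simpa using ht)]
    omega

lemma gradedBetti_ker_eq_zero {d : ℕ} (hd : 0 < d) {f : Fin n → MvPolynomial (Fin m) K}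
    (hf : ∀ i, (f i).IsHomogeneous d) {i : ℕ} {j : ℤ}
    (hij : reg (LexIdeal (graphIdeal d f)) < d * (j - i)) :
    gradedBetti (RingHom.ker (aeval f : MvPolynomial (Fin n) K →ₐ[K] MvPolynomial (Fin m) K))
      i j = 0 := by
  rcases lt_or_ge (j - i) 0 with hneg | hnn
  · exact gradedBetti_eq_zero_of_eq_bot (idealPiece_eq_bot_of_neg _ hneg)
  obtain ⟨k, hk⟩ := Int.eq_ofNat_of_zero_le hnn
  rcases k with _ | a
  · refine gradedBetti_eq_zero_of_eq_bot ?_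
    rw [hk]
    exact idealPiece_zero_eq_bot (RingHom.ker_ne_top _)
  have ha : j - ((i + 1 : ℕ) : ℤ) = (a : ℕ) := by push_cast at hk ⊢; omega
  refine gradedBetti_eq_zero_of_exact fun z hz hcard hbz => ?_
  rw [hk] at hz hij
  simp only [mem_idealPiece_natCast, RingHom.mem_ker] at hz
  obtain ⟨M, hM⟩ : ∃ M, d * (a + 1) + (d - 1) * i = M + 1 :=
    Nat.exists_eq_add_one.2 (by positivity)
  have hreg : reg (LexIdeal (graphIdeal d f)) ≤ M := by
    have h1 : (d * (a + 1) : ℕ) ≤ M + 1 := by omega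
    have h2 : (d : ℤ) * ((a + 1 : ℕ) : ℤ) ≤ M + 1 := by exact_mod_cast h1
    omega
  have hZ : ∀ s, expandChain d z s ∈
      idealPiece ((graphIdeal d f).comap (rename (Fin.castAdd m))) ((M + 1 : ℕ) : ℤ) := by
    intro s
    by_cases hs : s.card = i
    · rw [mem_idealPiece_natCast]
      refine ⟨Ideal.mul_mem_left _ _ (expand_mem_comap_graphIdeal d (hz s).1), ?_⟩
      rw [← hM, ← hs]
      exact expandChain_isHomogeneous (hz s).2
    · rw [expandChain, hcard s hs, map_zero, mul_zero]
      exact Submodule.zero_mem _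
  obtain ⟨v, hv, hvz⟩ := exists_eq_polyBdry_comap (graphIdeal_ne_top hd hf) hreg hZ
    fun s => by rw [polyBdry_expandChain hd, hbz, map_zero, mul_zero]
  simp only [mem_idealPiece_natCast] at hv
  refine ⟨fun s => if s.card = i + 1 then extract (fun _ => hd) (predOn d s) (v s) else 0,
    fun s => ?_, fun s => ?_⟩
  · rw [ha]
    dsimp only
    split_ifs with hs
    · rw [mem_idealPiece_natCast, RingHom.mem_ker]
      refine ⟨extract_mem_ker hd (fun t => ?_) (hv s).1, extract_isHomogeneous hd ?_⟩
      · rw [predOn]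
        split_ifs <;> omega
      · convert (hv s).2 using 1
        rw [sum_predOn, hs]
        rw [mul_add] at hM ⊢
        omega
    · exact Submodule.zero_mem _
  · by_cases hs : s.card = i
    · rw [← extract_monomial_mul_expand hd (predOn d s) (z s)]
      change extract (fun _ => hd) (predOn d s) (expandChain d z s) = _
      rw [hvz, extract_polyBdry]
      refine polyBdry_congr fun t ht => ?_
      rw [if_pos (by rw [Finset.card_insert_of_notMem ht, hs])]
    · rw [hcard s hs, polyBdry_eq_zero_of_card (i := i) (fun r hr => if_neg hr) hs]

end Transfer

/-- Let `P` be the kernel of the `K`-algebra map `φ : K[x_1,…,x_n] → K[y_1,…,y_m]` with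
`φ(x_i) = f_i`, the `f_i` homogeneous of common degree `d > 0`.  Let
`J' = (x_1^d - f_1, …, x_n^d - f_n)` in `S = K[x_1,…,x_n,y_1,…,y_m]` and let
`G_{n,d,m} = reg(Lex(J'))` be the regularity of the lexicographic ideal of `J'`.
Then `reg(P) ≤ G_{n,d,m}/d`. -/
theorem reg_kernel_le_reg_lexIdeal_div {n m : ℕ} (d : ℕ) (hd : 0 < d)
    (f : Fin n → MvPolynomial (Fin m) K) (hf : ∀ i, (f i).IsHomogeneous d) :
    (reg (RingHom.ker (aeval f : MvPolynomial (Fin n) K →ₐ[K] MvPolynomial (Fin m) K)) : ℚ) ≤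
      (reg (LexIdeal (Ideal.span (Set.range (fun i : Fin n =>
          (X (Fin.castAdd m i) : MvPolynomial (Fin (n + m)) K) ^ d -
            rename (Fin.natAdd n) (f i))))) : ℚ) / d := by
  rw [le_div_iff₀ (by exact_mod_cast hd)]
  change _ ≤ ((reg (LexIdeal (graphIdeal d f)) : ℤ) : ℚ)
  have hbound : ∀ r ∈ {r : ℤ | ∃ (i : ℕ) (j : ℤ), gradedBetti (RingHom.ker
      (aeval f : MvPolynomial (Fin n) K →ₐ[K] MvPolynomial (Fin m) K)) i j ≠ 0 ∧ r = j - i},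
      r * d ≤ reg (LexIdeal (graphIdeal d f)) := by
    rintro r ⟨i, j, hij, rfl⟩
    rw [mul_comm]
    exact not_lt.1 fun h => hij (gradedBetti_ker_eq_zero hd hf h)
  rw [reg]
  rcases Set.eq_empty_or_nonempty {r : ℤ | ∃ (i : ℕ) (j : ℤ), gradedBetti (RingHom.ker
      (aeval f : MvPolynomial (Fin n) K →ₐ[K] MvPolynomial (Fin m) K)) i j ≠ 0 ∧ r = j - i}
    with h | h
  · rw [h, Int.csSup_empty, Int.cast_zero, zero_mul]
    exact_mod_cast reg_lexIdeal_nonneg (graphIdeal_ne_top hd hf)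
  · have hd' : (0 : ℤ) < d := by exact_mod_cast hd
    have hmem := Int.csSup_mem h
      ⟨_, fun r hr => (Int.le_ediv_iff_mul_le hd').2 (hbound r hr)⟩
    exact_mod_cast hbound _ hmem
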